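/- arXiv:2602.15943 — 4 statements merged into one kernel-verified Lean document; each statement's English description precedes it below -/
import Mathlib

section
/- For every real x > 0, the synchrotron function satisfies the closed analytic formula F(x) = −(π/√3) x + (4x)^{1/3} Γ(2/3) Σ_{n≥0} ( (−1/3)_n / ( (−2/3)_n (2/3)_n n! ) ) (x²/4)^n + (x^{11}/256)^{1/3} Γ(−8/3) Σ_{n≥0} ( (4/3)_n / ( (8/3)_n (7/3)_n n! ) ) (x²/4)^n, where both series converge absolutely for every x > 0 and (a)_n denotes the rising factorial (Pochhammer symbol). -/
/-- The modified Bessel function of the second kind, for ν > −1/2 and x > 0. -/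
noncomputable def besselK (ν x : ℝ) : ℝ :=
  (Real.sqrt Real.pi / Real.Gamma (ν + 1/2)) * (x/2) ^ ν *
    ∫ t in Set.Ioi (1:ℝ), Real.exp (-x * t) * (t^2 - 1) ^ (ν - 1/2)

/-- The synchrotron function F(x) = x ∫_x^∞ K_{5/3}(t) dt. -/
noncomputable def synchrotronF (x : ℝ) : ℝ :=
  x * ∫ t in Set.Ioi x, besselK (5/3) t

/-- The rising factorial (Pochhammer symbol) (a)_n = a(a+1)⋯(a+n−1). -/
def risingFactorial (a : ℝ) : ℕ → ℝ
  | 0 => 1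
  | n + 1 => risingFactorial a n * (a + n)

/-- Coefficient sequences of entire power series. -/
def EntireCoeff (a : ℕ → ℝ) : Prop := ∀ r : ℝ, Summable fun n => |a n * r ^ n|

/-- The sum of the power series with coefficients `a`. -/
noncomputable def powerSum (a : ℕ → ℝ) (z : ℝ) : ℝ := ∑' n, a n * z ^ n

/-- The coefficients of the derivative of a power series. -/
def derivCoeff (a : ℕ → ℝ) (n : ℕ) : ℝ := (n + 1) * a (n + 1)

namespace EntireCoeff

variable {a b : ℕ → ℝ}

theorem summable (ha : EntireCoeff a) (z : ℝ) : Summable fun n => a n * z ^ n :=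
  (ha z).of_abs

theorem hasSum (ha : EntireCoeff a) (z : ℝ) : HasSum (fun n => a n * z ^ n) (powerSum a z) :=
  (ha.summable z).hasSum

theorem of_ratio {q : ℕ → ℝ} {C : ℝ} (ha : ∀ n, a (n + 1) = a n * q n)
    (hq : ∀ n : ℕ, |q n| ≤ C / (n + 1)) : EntireCoeff a := by
  intro r
  refine summable_of_ratio_norm_eventually_le (r := 1 / 2) (by norm_num) ?_
  obtain ⟨N, hN⟩ := exists_nat_gt (2 * (C * |r|))
  filter_upwards [Filter.eventually_ge_atTop N] with n hn
  have hn' : (N : ℝ) ≤ n := by exact_mod_cast hn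
  have hn0 : (0 : ℝ) < n + 1 := by positivity
  have h : |q n| * |r| ≤ 1 / 2 := by
    calc |q n| * |r| ≤ C / (n + 1) * |r| := by gcongr; exact hq n
      _ = (C * |r|) / (n + 1) := by ring
      _ ≤ 1 / 2 := by rw [div_le_iff₀ hn0]; linarith
  simp only [Real.norm_eq_abs, abs_abs, ha, abs_mul, pow_succ]
  calc |a n| * |q n| * (|r ^ n| * |r|) = (|q n| * |r|) * (|a n| * |r ^ n|) := by ring
    _ ≤ 1 / 2 * (|a n| * |r ^ n|) := by gcongr

theorem of_abs_le {C : ℝ} (ha : EntireCoeff a) (h : ∀ n, |b n| ≤ C * |a n|) : EntireCoeff b := by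
  intro r
  refine Summable.of_nonneg_of_le (fun _ => abs_nonneg _) (fun n => ?_) ((ha r).mul_left C)
  rw [abs_mul, abs_mul, ← mul_assoc]
  gcongr
  exact h n

theorem derivCoeff (ha : EntireCoeff a) : EntireCoeff (derivCoeff a) := by
  intro r
  have h := (summable_nat_add_iff 1).2 (ha (2 * (|r| + 1)))
  refine Summable.of_nonneg_of_le (fun _ => abs_nonneg _) (fun n => ?_) h
  have h1 : ((n : ℝ) + 1) ≤ 2 ^ (n + 1) := by exact_mod_cast (Nat.lt_two_pow_self (n := n + 1)).le
  have h2 : |r| ^ n ≤ (|r| + 1) ^ (n + 1) := by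
    calc |r| ^ n ≤ (|r| + 1) ^ n := by gcongr; linarith
      _ ≤ (|r| + 1) ^ (n + 1) := pow_le_pow_right₀ (by linarith [abs_nonneg r]) (Nat.le_succ n)
  have h3 : (0 : ℝ) ≤ |r| + 1 := by positivity
  have h4 : (0 : ℝ) ≤ n + 1 := by positivity
  simp only [_root_.derivCoeff, abs_mul, abs_pow, abs_of_nonneg h3, abs_of_nonneg h4, mul_pow,
    abs_of_pos (zero_lt_two (α := ℝ))]
  calc ((n : ℝ) + 1) * |a (n + 1)| * |r| ^ n
      ≤ 2 ^ (n + 1) * |a (n + 1)| * (|r| + 1) ^ (n + 1) := by gcongr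
    _ = _ := by ring

theorem hasDerivAt (ha : EntireCoeff a) (z : ℝ) :
    HasDerivAt (powerSum a) (powerSum (_root_.derivCoeff a) z) z := by
  have hu := (summable_nat_add_iff (f := fun n : ℕ => n * |a n| * (|z| + 1) ^ (n - 1)) 1).1 (by
    refine (ha.derivCoeff (|z| + 1)).congr fun n => ?_
    have h3 : (0 : ℝ) ≤ |z| + 1 := by positivity
    have h4 : (0 : ℝ) ≤ n + 1 := by positivity
    simp [_root_.derivCoeff, abs_mul, abs_of_nonneg h3, abs_of_nonneg h4])
  have hd : ∀ n : ℕ, ∀ y : ℝ,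
      HasDerivAt (fun y => a n * y ^ n) (a n * (n * y ^ (n - 1))) y :=
    fun n y => (hasDerivAt_pow n y).const_mul (a n)
  have h := hasDerivAt_tsum_of_isPreconnected (y := z) (y₀ := z)
    (t := Metric.ball (0 : ℝ) (|z| + 1)) hu
    Metric.isOpen_ball (convex_ball _ _).isPreconnected (fun n y _ => hd n y) (fun n y hy => ?_)
    (by simp) (ha.summable z) (by simp)
  · have hs : Summable fun n : ℕ => a n * (n * z ^ (n - 1)) := by
      refine Summable.of_norm_bounded hu fun n => ?_
      rw [Real.norm_eq_abs, abs_mul, abs_mul, abs_pow, Nat.abs_cast, ← mul_assoc, mul_comm |a n|]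
      gcongr
      linarith
    have e : powerSum (_root_.derivCoeff a) z = ∑' n : ℕ, a n * (n * z ^ (n - 1)) := by
      rw [hs.tsum_eq_zero_add]
      simp [powerSum, _root_.derivCoeff, mul_comm, mul_left_comm]
    rw [e]
    exact h
  · have hy' : |y| ≤ |z| + 1 := by simpa using (Metric.mem_ball.1 hy).le
    rw [Real.norm_eq_abs, abs_mul, abs_mul, abs_pow, Nat.abs_cast, ← mul_assoc, mul_comm |a n|]
    gcongr

theorem continuous (ha : EntireCoeff a) : Continuous (powerSum a) :=
  continuous_iff_continuousAt.2 fun z => (ha.hasDerivAt z).continuousAt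

theorem hasSum_mul (ha : EntireCoeff a) (h0 : b 0 = 0) (h : ∀ n, b (n + 1) = a n) (z : ℝ) :
    HasSum (fun n => b n * z ^ n) (z * powerSum a z) := by
  refine (hasSum_nat_add_iff' 1).1 ?_
  simp only [Finset.range_one, Finset.sum_singleton, h0, zero_mul, sub_zero]
  refine ((ha.hasSum z).mul_left z).congr_fun fun n => ?_
  rw [h]; ring

end EntireCoeff

theorem powerSum_zero (a : ℕ → ℝ) : powerSum a 0 = a 0 := by
  rw [powerSum, tsum_eq_single 0 fun n hn => by simp [hn]]
  simp

/-- The coefficients of the confluent hypergeometric limit function `₀F₁(; a; z)`. -/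
noncomputable def limitCoeff (a : ℝ) (n : ℕ) : ℝ := 1 / (risingFactorial a n * n.factorial)

theorem risingFactorial_pos {a : ℝ} (ha : 0 < a) (n : ℕ) : 0 < risingFactorial a n := by
  induction n with
  | zero => simp [risingFactorial]
  | succ n ih => rw [risingFactorial]; positivity

theorem risingFactorial_succ' (a : ℝ) (n : ℕ) :
    risingFactorial a (n + 1) = a * risingFactorial (a + 1) n := by
  induction n with
  | zero => simp [risingFactorial]
  | succ n ih => rw [risingFactorial, ih, risingFactorial]; push_cast; ring

theorem limitCoeff_pos {a : ℝ} (ha : 0 < a) (n : ℕ) : 0 < limitCoeff a n := by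
  have := risingFactorial_pos ha n
  unfold limitCoeff; positivity

theorem limitCoeff_succ {a : ℝ} (ha : 0 < a) (n : ℕ) :
    (n + 1) * (a + n) * limitCoeff a (n + 1) = limitCoeff a n := by
  have := risingFactorial_pos ha n
  have : 0 < a + n := by positivity
  simp only [limitCoeff, risingFactorial, Nat.factorial_succ]
  push_cast
  field_simp

theorem entireCoeff_limitCoeff {a : ℝ} (ha : 0 < a) : EntireCoeff (limitCoeff a) := by
  refine EntireCoeff.of_ratio (q := fun n => 1 / ((n + 1) * (a + n))) (C := 1 / a)
    (fun n => ?_) fun n => ?_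
  · have : 0 < a + n := by positivity
    rw [← limitCoeff_succ ha n]; field_simp
  · have : 0 < a + n := by positivity
    rw [abs_of_pos (by positivity), div_div]
    apply one_div_le_one_div_of_le (by positivity)
    nlinarith [Nat.cast_nonneg (α := ℝ) n]

theorem one_le_powerSum_limitCoeff {a z : ℝ} (ha : 0 < a) (hz : 0 ≤ z) :
    1 ≤ powerSum (limitCoeff a) z := by
  have h := ((entireCoeff_limitCoeff ha).summable z).le_tsum 0
    fun n _ => mul_nonneg (limitCoeff_pos ha n).le (pow_nonneg hz n)
  simpa [limitCoeff, risingFactorial, powerSum] using h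

/-- The differential equation of `₀F₁(; a; z)`. -/
theorem powerSum_limitCoeff_ode {a : ℝ} (ha : 0 < a) (z : ℝ) :
    z * powerSum (derivCoeff (derivCoeff (limitCoeff a))) z +
      a * powerSum (derivCoeff (limitCoeff a)) z = powerSum (limitCoeff a) z := by
  have he := entireCoeff_limitCoeff ha
  have h1 := he.derivCoeff.derivCoeff.hasSum_mul (b := fun n => n * derivCoeff (limitCoeff a) n)
    (by simp) (fun n => by simp only [derivCoeff]; push_cast; ring) z
  refine (h1.add ((he.derivCoeff.hasSum z).mul_left a)).unique ?_
  refine (he.hasSum z).congr_fun fun n => ?_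
  rw [← limitCoeff_succ ha n, derivCoeff]; ring

/-- The coefficients `a n / (n + c)`, obtained from `a` by a weighted integration. -/
noncomputable def primCoeff (a : ℕ → ℝ) (c : ℝ) (n : ℕ) : ℝ := a n / (n + c)

theorem EntireCoeff.primCoeff {a : ℕ → ℝ} {c : ℝ} (ha : EntireCoeff a) (hc : 0 < c) :
    EntireCoeff (primCoeff a c) := by
  refine ha.of_abs_le (C := 1 / c) fun n => ?_
  have : 0 < n + c := by positivity
  rw [_root_.primCoeff, abs_div, abs_of_pos this, one_div_mul_eq_div]
  gcongr
  linarith [Nat.cast_nonneg (α := ℝ) n]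

theorem powerSum_primCoeff {a : ℕ → ℝ} {c : ℝ} (ha : EntireCoeff a) (hc : 0 < c) (z : ℝ) :
    z * powerSum (derivCoeff (primCoeff a c)) z + c * powerSum (primCoeff a c) z =
      powerSum a z := by
  have hp := ha.primCoeff hc
  have h1 := hp.derivCoeff.hasSum_mul (b := fun n => n * primCoeff a c n)
    (by simp) (fun n => by simp only [derivCoeff]; push_cast; ring) z
  refine (h1.add ((hp.hasSum z).mul_left c)).unique ?_
  refine (ha.hasSum z).congr_fun fun n => ?_
  have : 0 < n + c := by positivity
  simp only [primCoeff]
  field_simp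

theorem cast_sub_div_three_ne_zero (n : ℕ) {k : ℕ} (hk : k % 3 ≠ 0) : (n : ℝ) - k / 3 ≠ 0 := by
  intro h
  have h' : (3 * n : ℝ) = k := by linarith
  norm_cast at h'
  omega

/-- The coefficients of the first series in the closed form. -/
noncomputable def firstCoeff (n : ℕ) : ℝ :=
  risingFactorial (-1/3) n / (risingFactorial (-2/3) n * risingFactorial (2/3) n * n.factorial)

/-- The coefficients of the second series in the closed form. -/
noncomputable def secondCoeff (n : ℕ) : ℝ :=
  risingFactorial (4/3) n / (risingFactorial (8/3) n * risingFactorial (7/3) n * n.factorial)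

theorem entireCoeff_firstCoeff : EntireCoeff firstCoeff := by
  refine EntireCoeff.of_ratio (C := 2)
    (q := fun n => (n - 1 / 3) / ((n - 2 / 3) * (n + 2 / 3) * (n + 1))) (fun n => ?_) fun n => ?_
  · simp only [firstCoeff, risingFactorial, Nat.factorial_succ]
    push_cast
    rw [div_mul_div_comm]
    congr 1 <;> ring
  · have h1 : (0 : ℝ) < n + 1 := by positivity
    rw [abs_div, abs_mul, abs_of_pos h1, ← div_div]
    gcongr
    rw [div_le_iff₀ (abs_pos.2 (mul_ne_zero
      (by simpa using cast_sub_div_three_ne_zero n (k := 2) (by norm_num)) (by positivity)))]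
    rcases n with _ | n
    · norm_num [abs_le]
    · have : (0 : ℝ) ≤ n := n.cast_nonneg
      push_cast
      rw [abs_of_nonneg (by linarith), abs_of_nonneg (by nlinarith)]
      nlinarith

theorem entireCoeff_secondCoeff : EntireCoeff secondCoeff := by
  refine EntireCoeff.of_ratio (C := 1)
    (q := fun n => (n + 4 / 3) / ((n + 8 / 3) * (n + 7 / 3) * (n + 1))) (fun n => ?_) fun n => ?_
  · simp only [secondCoeff, risingFactorial, Nat.factorial_succ]
    push_cast
    rw [div_mul_div_comm]
    congr 1 <;> ring
  · have h0 : (0 : ℝ) ≤ n := n.cast_nonneg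
    rw [abs_of_nonneg (by positivity), ← div_div]
    gcongr
    rw [div_le_iff₀ (by positivity)]
    nlinarith

theorem firstCoeff_eq (n : ℕ) :
    firstCoeff n = (3 * n + 1) * (3 * n - 2) / (2 * (3 * n - 1)) * limitCoeff (4 / 3) n := by
  have h1 : (n : ℝ) - 1 / 3 ≠ 0 := by
    simpa using cast_sub_div_three_ne_zero n (k := 1) (by norm_num)
  have h2 : (n : ℝ) - 2 / 3 ≠ 0 := by
    simpa using cast_sub_div_three_ne_zero n (k := 2) (by norm_num)
  have h3 : (3 : ℝ) * n - 1 ≠ 0 := fun h => h1 (by linarith)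
  have h3' : (n : ℝ) + 1 / 3 ≠ 0 := by positivity
  have e1 : risingFactorial (-1 / 3) n = -1 / 3 * risingFactorial (2 / 3) n / (n - 1 / 3) := by
    rw [eq_div_iff h1]
    have := risingFactorial_succ' (-1 / 3) n
    rw [risingFactorial] at this
    norm_num at this ⊢
    linarith
  have e2 : risingFactorial (1 / 3) n = 1 / 3 * risingFactorial (4 / 3) n / (n + 1 / 3) := by
    rw [eq_div_iff h3']
    have := risingFactorial_succ' (1 / 3) n
    rw [risingFactorial] at this
    norm_num at this ⊢
    linarith
  have e3 : risingFactorial (-2 / 3) n = -2 / 3 * risingFactorial (1 / 3) n / (n - 2 / 3) := by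
    rw [eq_div_iff h2]
    have := risingFactorial_succ' (-2 / 3) n
    rw [risingFactorial] at this
    norm_num at this ⊢
    linarith
  have h4 := (risingFactorial_pos (a := 4 / 3) (by norm_num) n).ne'
  have h5 := (risingFactorial_pos (a := 2 / 3) (by norm_num) n).ne'
  have h6 : (n.factorial : ℝ) ≠ 0 := by positivity
  rw [firstCoeff, limitCoeff, e1, e3, e2]
  generalize risingFactorial (4 / 3) n = P at *
  generalize risingFactorial (2 / 3) n = Q at *
  generalize (n.factorial : ℝ) = R at *
  have h1' : 3 * (n : ℝ) - 1 = 3 * (n - 1 / 3) := by ring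
  have h2' : 3 * (n : ℝ) - 2 = 3 * (n - 2 / 3) := by ring
  have h3'' : 3 * (n : ℝ) + 1 = 3 * (n + 1 / 3) := by ring
  rw [h1', h2', h3'']
  generalize (n : ℝ) - 1 / 3 = a at *
  generalize (n : ℝ) - 2 / 3 = b at *
  generalize (n : ℝ) + 1 / 3 = c at *
  field_simp

theorem powerSum_firstCoeff (z : ℝ) :
    -(4 / 3) * powerSum firstCoeff z =
      -(4 / 3) * powerSum (limitCoeff (4 / 3)) z -
        4 * (z * powerSum (derivCoeff (limitCoeff (4 / 3))) z) +
        2 * (z * powerSum (primCoeff (limitCoeff (4 / 3)) (2 / 3)) z) := by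
  have he := entireCoeff_limitCoeff (a := 4 / 3) (by norm_num)
  have h1 := he.derivCoeff.hasSum_mul (b := fun n => n * limitCoeff (4 / 3) n)
    (by simp) (fun n => by simp only [derivCoeff]; push_cast; ring) z
  have h2 := (he.primCoeff (c := 2 / 3) (by norm_num)).hasSum_mul
    (b := fun n => n * (n + 1 / 3) / (n - 1 / 3) * limitCoeff (4 / 3) n) (by simp)
    (fun n => by
      rw [primCoeff, ← limitCoeff_succ (a := 4 / 3) (by norm_num) n]
      push_cast
      rw [show (n : ℝ) + 1 - 1 / 3 = n + 2 / 3 by ring]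
      have : (n : ℝ) + 2 / 3 ≠ 0 := by positivity
      field_simp
      ring) z
  refine ((entireCoeff_firstCoeff.hasSum z).mul_left _).unique ?_
  refine ((((he.hasSum z).mul_left _).sub (h1.mul_left 4)).add (h2.mul_left 2)).congr_fun
    fun n => ?_
  have h1 : (n : ℝ) - 1 / 3 ≠ 0 := by
    simpa using cast_sub_div_three_ne_zero n (k := 1) (by norm_num)
  have h3 : (3 : ℝ) * n - 1 = 3 * (n - 1 / 3) := by ring
  rw [firstCoeff_eq, h3]
  obtain ⟨w, hw⟩ : ∃ w : ℝ, w = n - 1 / 3 := ⟨_, rfl⟩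
  have hn : (n : ℝ) = w + 1 / 3 := by linarith
  rw [← hw] at h1 ⊢
  rw [hn]
  field_simp
  ring

theorem powerSum_secondCoeff (z : ℝ) :
    -(27 / 80) * (z * powerSum secondCoeff z) =
      1 / 2 * powerSum (primCoeff (limitCoeff (2 / 3)) (1 / 3)) z -
        powerSum (derivCoeff (limitCoeff (2 / 3))) z := by
  have he := entireCoeff_limitCoeff (a := 2 / 3) (by norm_num)
  have h1 := (((he.primCoeff (c := 1 / 3) (by norm_num)).hasSum z).mul_left (1 / 2)).sub
    (he.derivCoeff.hasSum z)
  have h2 := entireCoeff_secondCoeff.hasSum_mul (z := z)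
    (b := fun n => -(80 / 27) * (1 / 2 * primCoeff (limitCoeff (2 / 3)) (1 / 3) n -
      derivCoeff (limitCoeff (2 / 3)) n)) ?_ fun n => ?_
  · refine (h2.mul_left (-(27 / 80))).unique (h1.congr_fun fun n => ?_)
    ring
  · norm_num [primCoeff, derivCoeff, limitCoeff, risingFactorial]
  · have e1 : risingFactorial (7 / 3) n = 3 / 4 * (risingFactorial (4 / 3) n * (n + 4 / 3)) := by
      have := risingFactorial_succ' (4 / 3) n
      rw [risingFactorial] at this
      norm_num at this ⊢
      linarith
    have e2 : risingFactorial (2 / 3) (n + 1 + 1) = 10 / 9 * risingFactorial (8 / 3) n := by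
      rw [risingFactorial_succ', risingFactorial_succ']
      norm_num
      ring
    have e3 : risingFactorial (2 / 3) (n + 1) =
        10 / 9 * risingFactorial (8 / 3) n / (n + 5 / 3) := by
      rw [eq_div_iff (by positivity), ← e2]
      change _ = risingFactorial (2 / 3) (n + 1) * (2 / 3 + ((n + 1 : ℕ) : ℝ))
      push_cast
      ring
    have h4 := (risingFactorial_pos (a := 4 / 3) (by norm_num) n).ne'
    have h5 := (risingFactorial_pos (a := 8 / 3) (by norm_num) n).ne'
    have h6 : (n.factorial : ℝ) ≠ 0 := by positivity
    rw [secondCoeff, primCoeff, derivCoeff, limitCoeff, limitCoeff, e1, e2, e3]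
    simp only [Nat.factorial_succ]
    push_cast
    have h7 : (n : ℝ) + 4 / 3 ≠ 0 := by positivity
    have h8 : (n : ℝ) + 1 + 1 / 3 = n + 4 / 3 := by ring
    have h9 : (n : ℝ) + 5 / 3 ≠ 0 := by positivity
    rw [h8]
    field_simp
    ring

section ClosedForm

open MeasureTheory Filter Topology Set

section BetaIntegral

variable {u v : ℝ}

theorem ofReal_beta_integrand {x : ℝ} (hx : x ∈ Ioc (0 : ℝ) 1) :
    (x : ℂ) ^ ((u : ℂ) - 1) * (1 - (x : ℂ)) ^ ((v : ℂ) - 1) =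
      ((x ^ (u - 1) * (1 - x) ^ (v - 1) : ℝ) : ℂ) := by
  have h1 : 0 ≤ 1 - x := by linarith [hx.2]
  rw [Complex.ofReal_mul, Complex.ofReal_cpow hx.1.le, Complex.ofReal_cpow h1]
  push_cast
  rfl

theorem integrableOn_beta_integrand (hu : 0 < u) (hv : 0 < v) :
    IntegrableOn (fun x : ℝ => x ^ (u - 1) * (1 - x) ^ (v - 1)) (Ioo 0 1) := by
  have h := Complex.betaIntegral_convergent (u := u) (v := v) (by simpa) (by simpa)
  rw [intervalIntegrable_iff_integrableOn_Ioc_of_le (by simp)] at h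
  have h2 := h.congr_fun (fun x hx => ofReal_beta_integrand hx) measurableSet_Ioc
  refine IntegrableOn.mono_set ?_ Ioo_subset_Ioc_self
  simpa [IntegrableOn] using h2.re

theorem integral_beta_integrand (hu : 0 < u) (hv : 0 < v) :
    ∫ x in Ioo (0 : ℝ) 1, x ^ (u - 1) * (1 - x) ^ (v - 1) =
      Real.Gamma u * Real.Gamma v / Real.Gamma (u + v) := by
  have h := ProbabilityTheory.beta_eq_betaIntegralReal u v hu hv
  rw [ProbabilityTheory.beta, Complex.betaIntegral,
    intervalIntegral.integral_of_le (by norm_num),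
    setIntegral_congr_fun measurableSet_Ioc (fun x hx => ofReal_beta_integrand hx),
    integral_complex_ofReal, Complex.ofReal_re] at h
  rw [h, integral_Ioc_eq_integral_Ioo]

end BetaIntegral

/-- The substitution `y = x ^ (-1 / 2)` in the integrand `y ^ (-p) * (y ^ 2 - 1) ^ (v - 1)`. -/
theorem rpow_neg_half_integrand (p v : ℝ) {x : ℝ} (hx : x ∈ Ioi (0 : ℝ)) :
    (|(-1 / 2 : ℝ)| * x ^ ((-1 / 2 : ℝ) - 1)) •
      (Ioi (1 : ℝ)).indicator (fun y => y ^ (-p) * (y ^ 2 - 1) ^ (v - 1)) (x ^ (-1 / 2 : ℝ)) =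
    (Ioo (0 : ℝ) 1).indicator
      (fun x => 1 / 2 * (x ^ ((p + 1) / 2 - v - 1) * (1 - x) ^ (v - 1))) x := by
  have hx0 : 0 < x := hx
  have hmem : x ^ (-1 / 2 : ℝ) ∈ Ioi (1 : ℝ) ↔ x ∈ Ioo (0 : ℝ) 1 := by
    rw [mem_Ioi, Real.one_lt_rpow_iff_of_pos hx0, mem_Ioo]
    constructor
    · rintro (h | h)
      · linarith [h.2]
      · exact ⟨hx0, h.1⟩
    · intro h; right; exact ⟨h.2, by norm_num⟩
  by_cases h : x ∈ Ioo (0 : ℝ) 1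
  · rw [indicator_of_mem h, indicator_of_mem (hmem.2 h)]
    have h1 : 0 < 1 - x := by linarith [h.2]
    have h2 : (x ^ (-1 / 2 : ℝ)) ^ 2 - 1 = x ^ (-1 : ℝ) * (1 - x) := by
      rw [← Real.rpow_natCast, ← Real.rpow_mul hx0.le, mul_sub, mul_one, Real.rpow_neg_one,
        inv_mul_cancel₀ hx0.ne', ← Real.rpow_neg_one]
      norm_num
    rw [h2, Real.mul_rpow (by positivity) h1.le, ← Real.rpow_mul hx0.le, ← Real.rpow_mul hx0.le,
      smul_eq_mul]
    have h3 : x ^ ((p + 1) / 2 - v - 1) =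
        x ^ ((-1 / 2 : ℝ) - 1) * (x ^ (-1 / 2 * -p) * x ^ (-1 * (v - 1))) := by
      rw [← Real.rpow_add hx0, ← Real.rpow_add hx0]; congr 1; ring
    rw [h3, abs_of_neg (by norm_num)]
    ring
  · rw [indicator_of_notMem h, indicator_of_notMem (fun h' => h (hmem.1 h')), smul_zero]

theorem integrableOn_Ioi_one_beta {p v : ℝ} (hv : 0 < v) (hp : 0 < (p + 1) / 2 - v) :
    IntegrableOn (fun y : ℝ => y ^ (-p) * (y ^ 2 - 1) ^ (v - 1)) (Ioi 1) := by
  have h := (integrableOn_Ioi_comp_rpow_iff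
    ((Ioi (1 : ℝ)).indicator (fun y => y ^ (-p) * (y ^ 2 - 1) ^ (v - 1)))
    (p := -1 / 2) (by norm_num)).1
  rw [integrableOn_congr_fun (fun x hx => rpow_neg_half_integrand p v hx) measurableSet_Ioi] at h
  have h' := h (((integrable_indicator_iff measurableSet_Ioo).2
    ((integrableOn_beta_integrand hp hv).const_mul _)).integrableOn)
  rw [IntegrableOn, integrable_indicator_iff measurableSet_Ioi, IntegrableOn,
    Measure.restrict_restrict measurableSet_Ioi, Ioi_inter_Ioi] at h'
  simpa [IntegrableOn] using h'

theorem integral_Ioi_one_beta {p v : ℝ} (hv : 0 < v) (hp : 0 < (p + 1) / 2 - v) :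
    ∫ y in Ioi (1 : ℝ), y ^ (-p) * (y ^ 2 - 1) ^ (v - 1) =
      Real.Gamma ((p + 1) / 2 - v) * Real.Gamma v / (2 * Real.Gamma ((p + 1) / 2)) := by
  have h := integral_comp_rpow_Ioi
    ((Ioi (1 : ℝ)).indicator (fun y => y ^ (-p) * (y ^ 2 - 1) ^ (v - 1)))
    (p := -1 / 2) (by norm_num)
  rw [setIntegral_congr_fun measurableSet_Ioi (fun x hx => rpow_neg_half_integrand p v hx),
    setIntegral_indicator measurableSet_Ioo, setIntegral_indicator measurableSet_Ioi,
    Ioi_inter_Ioi, inter_eq_self_of_subset_right Ioo_subset_Ioi_self,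
    integral_const_mul, integral_beta_integrand hp hv] at h
  rw [sup_eq_right.2 zero_le_one] at h
  rw [← h]
  ring_nf

/-- The moments `∫₁^∞ tᵏ e^{-xt} (t² - 1)^{-5/6} dt`. -/
noncomputable def expMoment (k : ℕ) (x : ℝ) : ℝ :=
  ∫ t in Ioi (1 : ℝ), t ^ k * Real.exp (-x * t) * (t ^ 2 - 1) ^ (-5 / 6 : ℝ)

theorem integrableOn_weight :
    IntegrableOn (fun t : ℝ => (t ^ 2 - 1) ^ (-5 / 6 : ℝ)) (Ioi 1) := by
  have h := integrableOn_Ioi_one_beta (p := 0) (v := 1 / 6) (by norm_num) (by norm_num)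
  norm_num at h
  norm_num [h]

theorem sq_sub_one_pos {t : ℝ} (ht : t ∈ Ioi (1 : ℝ)) : 0 < t ^ 2 - 1 := by
  have : 1 < t := ht
  nlinarith

theorem pow_mul_exp_neg_le {x t : ℝ} (hx : 0 < x) (ht : 0 ≤ t) (k : ℕ) :
    t ^ k * Real.exp (-x * t) ≤ k.factorial / x ^ k := by
  have h := Real.pow_div_factorial_le_exp (x * t) (by positivity) k
  rw [neg_mul, Real.exp_neg, ← div_eq_mul_inv, div_le_div_iff₀ (Real.exp_pos _) (by positivity)]
  rw [div_le_iff₀ (by positivity), mul_pow] at h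
  linarith

theorem aestronglyMeasurable_moment (k : ℕ) (x : ℝ) :
    AEStronglyMeasurable (fun t : ℝ => t ^ k * Real.exp (-x * t) * (t ^ 2 - 1) ^ (-5 / 6 : ℝ))
      (volume.restrict (Ioi 1)) :=
  Measurable.aestronglyMeasurable (by fun_prop)

theorem integrableOn_moment (k : ℕ) {x : ℝ} (hx : 0 < x) :
    IntegrableOn (fun t : ℝ => t ^ k * Real.exp (-x * t) * (t ^ 2 - 1) ^ (-5 / 6 : ℝ))
      (Ioi 1) := by
  refine Integrable.bdd_mul (c := k.factorial / x ^ k) integrableOn_weight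
    (Measurable.aestronglyMeasurable (by fun_prop)) ?_
  refine ae_restrict_of_forall_mem measurableSet_Ioi fun t ht => ?_
  have ht0 : 0 ≤ t := zero_le_one.trans (le_of_lt ht)
  rw [Real.norm_eq_abs, abs_of_nonneg (by positivity)]
  exact pow_mul_exp_neg_le hx ht0 k

theorem hasDerivAt_expMoment (k : ℕ) {x : ℝ} (hx : 0 < x) :
    HasDerivAt (expMoment k) (-expMoment (k + 1) x) x := by
  have h := hasDerivAt_integral_of_dominated_loc_of_deriv_le
    (F := fun x t : ℝ => t ^ k * Real.exp (-x * t) * (t ^ 2 - 1) ^ (-5 / 6 : ℝ))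
    (F' := fun x t : ℝ => -(t ^ (k + 1) * Real.exp (-x * t) * (t ^ 2 - 1) ^ (-5 / 6 : ℝ)))
    (bound := fun t : ℝ => t ^ (k + 1) * Real.exp (-(x / 2) * t) * (t ^ 2 - 1) ^ (-5 / 6 : ℝ))
    (μ := volume.restrict (Ioi 1)) (Ioi_mem_nhds (half_lt_self hx))
    (Eventually.of_forall fun y => aestronglyMeasurable_moment k y)
    (integrableOn_moment k hx) (aestronglyMeasurable_moment (k + 1) x).neg
    (ae_restrict_of_forall_mem measurableSet_Ioi fun t ht y hy => ?_)
    (integrableOn_moment (k + 1) (half_pos hx))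
    (ae_restrict_of_forall_mem measurableSet_Ioi fun t ht y hy => ?_)
  · have h2 := h.2
    rw [integral_neg] at h2
    exact h2
  · have ht0 : 0 ≤ t := zero_le_one.trans (le_of_lt ht)
    have := (sq_sub_one_pos ht).le
    rw [norm_neg, Real.norm_eq_abs, abs_of_nonneg (by positivity)]
    have hy' : x / 2 ≤ y := le_of_lt hy
    gcongr
  · have h1 : HasDerivAt (fun y : ℝ => Real.exp (-y * t)) (Real.exp (-y * t) * (-1 * t)) y :=
      ((hasDerivAt_id y).neg.mul_const t).exp
    convert! (h1.const_mul (t ^ k)).mul_const ((t ^ 2 - 1) ^ (-5 / 6 : ℝ)) using 1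
    ring

theorem expMoment_by_parts (k : ℕ) {x : ℝ} (hx : 0 < x) :
    1 / 3 * expMoment (k + 1) x + k * (expMoment (k + 1) x - expMoment (k - 1) x) =
      x * (expMoment (k + 2) x - expMoment k x) := by
  have hi := fun k => integrableOn_moment k hx
  have hderiv : ∀ t ∈ Ioi (1 : ℝ),
      HasDerivAt (fun t : ℝ => t ^ k * Real.exp (-x * t) * (t ^ 2 - 1) ^ (1 / 6 : ℝ))
        (1 / 3 * (t ^ (k + 1) * Real.exp (-x * t) * (t ^ 2 - 1) ^ (-5 / 6 : ℝ)) +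
          k * (t ^ (k + 1) * Real.exp (-x * t) * (t ^ 2 - 1) ^ (-5 / 6 : ℝ) -
            t ^ (k - 1) * Real.exp (-x * t) * (t ^ 2 - 1) ^ (-5 / 6 : ℝ)) -
          x * (t ^ (k + 2) * Real.exp (-x * t) * (t ^ 2 - 1) ^ (-5 / 6 : ℝ) -
            t ^ k * Real.exp (-x * t) * (t ^ 2 - 1) ^ (-5 / 6 : ℝ))) t := by
    intro t ht
    have hpos := sq_sub_one_pos ht
    have h1 : HasDerivAt (fun t : ℝ => Real.exp (-x * t)) (Real.exp (-x * t) * (-x * 1)) t :=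
      ((hasDerivAt_id t).const_mul (-x)).exp
    have h2 := (((hasDerivAt_pow 2 t).sub_const 1).rpow_const (p := 1 / 6) (Or.inl hpos.ne'))
    convert! ((hasDerivAt_pow k t).mul h1).mul h2 using 1
    have e1 : (t ^ 2 - 1) ^ (1 / 6 : ℝ) = (t ^ 2 - 1) * (t ^ 2 - 1) ^ (-5 / 6 : ℝ) := by
      nth_rewrite 2 [← Real.rpow_one (t ^ 2 - 1)]
      rw [← Real.rpow_add hpos]; norm_num
    have e2 : (1 / 6 - 1 : ℝ) = -5 / 6 := by norm_num
    rw [Pi.mul_apply, e1, e2]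
    rcases k with _ | k
    · simp; ring
    · simp only [Nat.add_sub_cancel]; push_cast; ring
  have hlim : Tendsto (fun t : ℝ => t ^ k * Real.exp (-x * t) * (t ^ 2 - 1) ^ (1 / 6 : ℝ))
      atTop (𝓝 0) := by
    have h := tendsto_rpow_mul_exp_neg_mul_atTop_nhds_zero ((k + 1 : ℕ) : ℝ) x hx
    refine tendsto_of_tendsto_of_tendsto_of_le_of_le' tendsto_const_nhds h ?_ ?_
    · filter_upwards [eventually_gt_atTop 1] with t ht
      have := (sq_sub_one_pos ht).le
      positivity
    · filter_upwards [eventually_gt_atTop 1] with t ht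
      have hpos := (sq_sub_one_pos ht).le
      have ht0 : 0 ≤ t := zero_le_one.trans (le_of_lt ht)
      have : (t ^ 2 - 1) ^ (1 / 6 : ℝ) ≤ t := by
        calc (t ^ 2 - 1) ^ (1 / 6 : ℝ) ≤ (t ^ 2) ^ (1 / 6 : ℝ) := by gcongr; linarith
          _ = t ^ (1 / 3 : ℝ) := by
            rw [← Real.rpow_natCast, ← Real.rpow_mul ht0]; norm_num
          _ ≤ t ^ (1 : ℝ) := Real.rpow_le_rpow_of_exponent_le ht.le (by norm_num)
          _ = t := Real.rpow_one t
      rw [Real.rpow_natCast, pow_succ]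
      calc t ^ k * Real.exp (-x * t) * (t ^ 2 - 1) ^ (1 / 6 : ℝ)
          ≤ t ^ k * Real.exp (-x * t) * t := by gcongr
        _ = _ := by ring
  have hcont : Continuous fun t : ℝ =>
      t ^ k * Real.exp (-x * t) * (t ^ 2 - 1) ^ (1 / 6 : ℝ) :=
    Continuous.mul (by fun_prop)
      (Continuous.rpow_const (by fun_prop) fun _ => Or.inr (by norm_num))
  have ha := (hi (k + 1)).const_mul (1 / 3)
  have hb : Integrable (fun t : ℝ =>
      k * (t ^ (k + 1) * Real.exp (-x * t) * (t ^ 2 - 1) ^ (-5 / 6 : ℝ) -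
        t ^ (k - 1) * Real.exp (-x * t) * (t ^ 2 - 1) ^ (-5 / 6 : ℝ))) (volume.restrict (Ioi 1)) :=
    ((hi (k + 1)).sub (hi (k - 1))).const_mul (k : ℝ)
  have hc : Integrable (fun t : ℝ =>
      x * (t ^ (k + 2) * Real.exp (-x * t) * (t ^ 2 - 1) ^ (-5 / 6 : ℝ) -
        t ^ k * Real.exp (-x * t) * (t ^ 2 - 1) ^ (-5 / 6 : ℝ))) (volume.restrict (Ioi 1)) :=
    ((hi (k + 2)).sub (hi k)).const_mul x
  have h := integral_Ioi_of_hasDerivAt_of_tendsto hcont.continuousWithinAt hderiv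
    ((ha.add hb).sub hc) hlim
  have h0 : ((1 : ℝ) ^ 2 - 1) ^ (1 / 6 : ℝ) = 0 := by norm_num
  rw [h0, mul_zero, sub_zero] at h
  rw [integral_sub (by exact ha.add hb) hc, integral_add ha hb, integral_const_mul,
    integral_const_mul,
    integral_const_mul, integral_sub (hi _) (hi _), integral_sub (hi _) (hi _)] at h
  exact sub_eq_zero.1 h

theorem expMoment_nonneg (k : ℕ) (x : ℝ) : 0 ≤ expMoment k x := by
  refine setIntegral_nonneg measurableSet_Ioi fun t ht => ?_
  have := (sq_sub_one_pos ht).le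
  have ht0 : 0 ≤ t := zero_le_one.trans (le_of_lt ht)
  positivity

theorem expMoment_le (k : ℕ) {x : ℝ} (hx : 0 < x) :
    expMoment k x ≤ k.factorial / x ^ k * ∫ t in Ioi (1 : ℝ), (t ^ 2 - 1) ^ (-5 / 6 : ℝ) := by
  rw [← integral_const_mul]
  refine setIntegral_mono_on (integrableOn_moment k hx) (integrableOn_weight.const_mul _)
    measurableSet_Ioi fun t ht => ?_
  have := (sq_sub_one_pos ht).le
  have ht0 : 0 ≤ t := zero_le_one.trans (le_of_lt ht)
  gcongr
  exact pow_mul_exp_neg_le hx ht0 k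

theorem tendsto_expMoment_zero :
    Tendsto (expMoment 0) (𝓝[>] 0) (𝓝 (∫ t in Ioi (1 : ℝ), (t ^ 2 - 1) ^ (-5 / 6 : ℝ))) := by
  refine tendsto_integral_filter_of_dominated_convergence
    (fun t : ℝ => (t ^ 2 - 1) ^ (-5 / 6 : ℝ))
    (Eventually.of_forall fun y => aestronglyMeasurable_moment 0 y) ?_ integrableOn_weight ?_
  · filter_upwards [self_mem_nhdsWithin] with x hx
    refine ae_restrict_of_forall_mem measurableSet_Ioi fun t ht => ?_
    have hpos := (sq_sub_one_pos ht).le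
    have ht0 : 0 ≤ t := zero_le_one.trans (le_of_lt ht)
    rw [Real.norm_eq_abs, abs_of_nonneg (by positivity)]
    refine mul_le_of_le_one_left (by positivity) ?_
    rw [pow_zero, one_mul, Real.exp_le_one_iff]
    have hx' : 0 < x := hx
    nlinarith
  · refine Eventually.of_forall fun t => ?_
    have h : Continuous fun x : ℝ => t ^ 0 * Real.exp (-x * t) * (t ^ 2 - 1) ^ (-5 / 6 : ℝ) := by
      fun_prop
    simpa using (h.tendsto 0).mono_left nhdsWithin_le_nhds

/-- A rescaled form of the first moment, suited to the limit `x → 0`. -/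
theorem rpow_mul_expMoment_one {x : ℝ} (hx : 0 < x) :
    x ^ (1 / 3 : ℝ) * expMoment 1 x = 3 * ∫ u in Ioi (0 : ℝ),
      (Ioi x).indicator (fun u => Real.exp (-u) * (u ^ 2 - x ^ 2) ^ (1 / 6 : ℝ)) u := by
  have h1 := expMoment_by_parts 0 hx
  rw [Nat.cast_zero, zero_mul, add_zero, zero_add, zero_add, expMoment, expMoment, expMoment,
    ← integral_sub (integrableOn_moment 2 hx) (integrableOn_moment 0 hx)] at h1
  have h2 : ∫ t in Ioi (1 : ℝ), (t ^ 2 * Real.exp (-x * t) * (t ^ 2 - 1) ^ (-5 / 6 : ℝ) -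
      t ^ 0 * Real.exp (-x * t) * (t ^ 2 - 1) ^ (-5 / 6 : ℝ)) =
      x ^ (-1 / 3 : ℝ) * ∫ t in Ioi (1 : ℝ),
        Real.exp (-(x * t)) * ((x * t) ^ 2 - x ^ 2) ^ (1 / 6 : ℝ) := by
    rw [← integral_const_mul]
    refine setIntegral_congr_fun measurableSet_Ioi fun t ht => ?_
    have hpos := sq_sub_one_pos ht
    have e1 : (t ^ 2 - 1) ^ (1 / 6 : ℝ) = (t ^ 2 - 1) * (t ^ 2 - 1) ^ (-5 / 6 : ℝ) := by
      nth_rewrite 2 [← Real.rpow_one (t ^ 2 - 1)]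
      rw [← Real.rpow_add hpos]; norm_num
    have e2 : ((x * t) ^ 2 - x ^ 2) ^ (1 / 6 : ℝ) =
        x ^ (1 / 3 : ℝ) * (t ^ 2 - 1) ^ (1 / 6 : ℝ) := by
      rw [show (x * t) ^ 2 - x ^ 2 = x ^ 2 * (t ^ 2 - 1) by ring,
        Real.mul_rpow (by positivity) hpos.le, ← Real.rpow_natCast, ← Real.rpow_mul hx.le]
      norm_num
    have e3 : x ^ (-1 / 3 : ℝ) * x ^ (1 / 3 : ℝ) = 1 := by
      rw [← Real.rpow_add hx]; norm_num
    simp only [e2, e1, neg_mul]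
    linear_combination (-Real.exp (-(x * t)) * ((t ^ 2 - 1) * (t ^ 2 - 1) ^ (-5 / 6 : ℝ))) * e3
  rw [h2, integral_comp_mul_left_Ioi
    (fun u => Real.exp (-u) * (u ^ 2 - x ^ 2) ^ (1 / 6 : ℝ)) 1 hx, smul_eq_mul, mul_one] at h1
  rw [setIntegral_indicator measurableSet_Ioi, Ioi_inter_Ioi, sup_eq_right.2 hx.le]
  have e3 : x ^ (1 / 3 : ℝ) * x ^ (-1 / 3 : ℝ) = 1 := by
    rw [← Real.rpow_add hx]; norm_num
  rw [expMoment]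
  set I := ∫ u in Ioi x, Real.exp (-u) * (u ^ 2 - x ^ 2) ^ (1 / 6 : ℝ)
  have e4 : x * (x ^ (-1 / 3 : ℝ) * (x⁻¹ * I)) = x ^ (-1 / 3 : ℝ) * I := by field_simp
  rw [e4] at h1
  linear_combination 3 * x ^ (1 / 3 : ℝ) * h1 + 3 * I * e3

theorem tendsto_rpow_mul_expMoment_one :
    Tendsto (fun x => x ^ (1 / 3 : ℝ) * expMoment 1 x) (𝓝[>] 0) (𝓝 (Real.Gamma (1 / 3))) := by
  have hG : Real.Gamma (1 / 3) = 3 * ∫ u in Ioi (0 : ℝ), Real.exp (-u) * u ^ (1 / 3 : ℝ) := by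
    have h := Real.Gamma_add_one (s := 1 / 3) (by norm_num)
    rw [Real.Gamma_eq_integral (s := 1 / 3 + 1) (by norm_num)] at h
    norm_num at h
    norm_num
    linarith
  have hint := Real.GammaIntegral_convergent (s := 4 / 3) (by norm_num)
  norm_num at hint
  rw [hG]
  refine Tendsto.congr' (f₁ := fun x => 3 * ∫ u in Ioi (0 : ℝ),
      (Ioi x).indicator (fun u => Real.exp (-u) * (u ^ 2 - x ^ 2) ^ (1 / 6 : ℝ)) u) ?_ ?_
  · filter_upwards [self_mem_nhdsWithin] with x hx
    exact (rpow_mul_expMoment_one hx).symm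
  refine Tendsto.const_mul 3 (tendsto_integral_filter_of_dominated_convergence
    (fun u : ℝ => Real.exp (-u) * u ^ (1 / 3 : ℝ)) ?_ ?_ hint ?_)
  · exact Eventually.of_forall fun x => Measurable.aestronglyMeasurable
      (Measurable.indicator (by fun_prop) measurableSet_Ioi)
  · filter_upwards [self_mem_nhdsWithin] with x hx
    refine ae_restrict_of_forall_mem measurableSet_Ioi fun u hu => ?_
    have hx0 : 0 < x := hx
    have hu0 : 0 < u := hu
    by_cases h : u ∈ Ioi x
    · have hxu : x < u := h
      have hpos : 0 ≤ u ^ 2 - x ^ 2 := by nlinarith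
      rw [indicator_of_mem h, Real.norm_eq_abs, abs_of_nonneg (by positivity)]
      gcongr
      calc (u ^ 2 - x ^ 2) ^ (1 / 6 : ℝ) ≤ (u ^ 2) ^ (1 / 6 : ℝ) := by
            gcongr; nlinarith
        _ = u ^ (1 / 3 : ℝ) := by
            rw [← Real.rpow_natCast, ← Real.rpow_mul hu0.le]; norm_num
    · rw [indicator_of_notMem h, norm_zero]
      positivity
  · refine ae_restrict_of_forall_mem measurableSet_Ioi fun u hu => ?_
    have hu0 : 0 < u := hu
    have hc : Continuous fun x : ℝ => Real.exp (-u) * (u ^ 2 - x ^ 2) ^ (1 / 6 : ℝ) :=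
      Continuous.mul (by fun_prop)
        (Continuous.rpow_const (by fun_prop) fun _ => Or.inr (by norm_num))
    have h0 := (hc.tendsto 0).mono_left (nhdsWithin_le_nhds (s := Ioi 0))
    have e : (u ^ 2 - 0 ^ 2) ^ (1 / 6 : ℝ) = u ^ (1 / 3 : ℝ) := by
      rw [show u ^ 2 - 0 ^ 2 = u ^ 2 by ring, ← Real.rpow_natCast, ← Real.rpow_mul hu0.le]; norm_num
    simp only [e] at h0
    refine h0.congr' ?_
    filter_upwards [nhdsWithin_le_nhds (Iio_mem_nhds hu0)] with x hx
    rw [indicator_of_mem (show u ∈ Ioi x from hx)]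

theorem rpow_mul_moment_integrand_nonneg {u t : ℝ} (hu : u ∈ Ioi (0 : ℝ))
    (ht : t ∈ Ioi (1 : ℝ)) :
    0 ≤ u ^ (-1 / 3 : ℝ) * (t ^ 0 * Real.exp (-u * t) * (t ^ 2 - 1) ^ (-5 / 6 : ℝ)) := by
  have := (sq_sub_one_pos ht).le
  have : 0 < u := hu
  positivity

theorem integral_rpow_mul_moment_integrand {t : ℝ} (ht : t ∈ Ioi (1 : ℝ)) :
    ∫ u in Ioi (0 : ℝ), u ^ (-1 / 3 : ℝ) *
      (t ^ 0 * Real.exp (-u * t) * (t ^ 2 - 1) ^ (-5 / 6 : ℝ)) =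
    Real.Gamma (2 / 3) * (t ^ (-(2 / 3) : ℝ) * (t ^ 2 - 1) ^ ((1 / 6 : ℝ) - 1)) := by
  have ht0 : 0 < t := zero_lt_one.trans ht
  have h := Real.integral_rpow_mul_exp_neg_mul_Ioi (a := 2 / 3) (r := t) (by norm_num) ht0
  rw [one_div, Real.inv_rpow ht0.le, ← Real.rpow_neg ht0.le] at h
  have e : ((1 / 6 : ℝ) - 1) = -5 / 6 := by norm_num
  rw [e, ← mul_assoc, mul_comm (Real.Gamma _), ← h, ← integral_mul_const]
  refine setIntegral_congr_fun measurableSet_Ioi fun u _ => ?_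
  have e2 : ((2 / 3 : ℝ) - 1) = -1 / 3 := by norm_num
  simp only [e2, pow_zero, one_mul, neg_mul, mul_comm u t]
  ring

theorem integrable_rpow_mul_moment_integrand :
    Integrable (Function.uncurry fun u t : ℝ =>
      u ^ (-1 / 3 : ℝ) * (t ^ 0 * Real.exp (-u * t) * (t ^ 2 - 1) ^ (-5 / 6 : ℝ)))
      ((volume.restrict (Ioi 0)).prod (volume.restrict (Ioi 1))) := by
  refine (integrable_prod_iff' (Measurable.aestronglyMeasurable (by fun_prop))).2 ⟨?_, ?_⟩
  · refine ae_restrict_of_forall_mem measurableSet_Ioi fun t ht => ?_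
    refine not_not.1 fun h => ?_
    have h' := (integral_rpow_mul_moment_integrand ht).symm.trans (integral_undef h)
    have h1 : 0 < t ^ 2 - 1 := sq_sub_one_pos ht
    have h2 : 0 < t := zero_lt_one.trans ht
    have h3 : 0 < Real.Gamma (2 / 3) := Real.Gamma_pos_of_pos (by norm_num)
    have : 0 < Real.Gamma (2 / 3) * (t ^ (-(2 / 3) : ℝ) * (t ^ 2 - 1) ^ ((1 / 6 : ℝ) - 1)) := by
      positivity
    linarith
  · have h := (integrableOn_Ioi_one_beta (p := 2 / 3) (v := 1 / 6) (by norm_num)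
      (by norm_num)).const_mul (Real.Gamma (2 / 3))
    refine IntegrableOn.congr_fun h (fun t ht => ?_) measurableSet_Ioi
    refine (integral_rpow_mul_moment_integrand ht).symm.trans ?_
    refine setIntegral_congr_fun measurableSet_Ioi fun u hu => ?_
    exact (Real.norm_of_nonneg (rpow_mul_moment_integrand_nonneg hu ht)).symm

theorem integrableOn_rpow_mul_expMoment :
    IntegrableOn (fun u => u ^ (-1 / 3 : ℝ) * expMoment 0 u) (Ioi 0) := by
  have h := integrable_rpow_mul_moment_integrand.integral_prod_left
  simpa only [Function.uncurry_apply_pair, integral_const_mul, IntegrableOn, expMoment] using h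

theorem integral_rpow_mul_expMoment :
    ∫ u in Ioi (0 : ℝ), u ^ (-1 / 3 : ℝ) * expMoment 0 u =
      Real.Gamma (2 / 3) * ∫ t in Ioi (1 : ℝ),
        t ^ (-(2 / 3) : ℝ) * (t ^ 2 - 1) ^ ((1 / 6 : ℝ) - 1) := by
  have h := integral_integral_swap integrable_rpow_mul_moment_integrand
  rw [setIntegral_congr_fun measurableSet_Ioi
    (fun t ht => integral_rpow_mul_moment_integrand ht), integral_const_mul] at h
  rw [← h]
  simp only [integral_const_mul]
  rfl

theorem hasDerivAt_powerSum_sq {a : ℕ → ℝ} (ha : EntireCoeff a) (x : ℝ) :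
    HasDerivAt (fun x => powerSum a (x ^ 2 / 4))
      (x / 2 * powerSum (derivCoeff a) (x ^ 2 / 4)) x := by
  have h1 : HasDerivAt (fun x : ℝ => x ^ 2 / 4) (x / 2) x := by
    convert! (hasDerivAt_pow 2 x).div_const 4 using 1
    norm_num
    ring
  convert! (ha.hasDerivAt (x ^ 2 / 4)).comp x h1 using 1
  ring

theorem continuous_powerSum_sq {a : ℕ → ℝ} (ha : EntireCoeff a) :
    Continuous fun x : ℝ => powerSum a (x ^ 2 / 4) :=
  ha.continuous.comp (by fun_prop)

theorem rpow_third {y : ℝ} (hy : 0 < y) (p : ℝ) (n : ℤ) (hp : 3 * p = n) :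
    (y ^ 3) ^ p = y ^ n := by
  rw [← Real.rpow_natCast, ← Real.rpow_mul hy.le, ← Real.rpow_intCast, ← hp]
  norm_num

theorem exists_cube {x : ℝ} (hx : 0 < x) : ∃ y : ℝ, 0 < y ∧ y ^ 3 = x := by
  refine ⟨x ^ (1 / 3 : ℝ), by positivity, ?_⟩
  rw [← Real.rpow_natCast, ← Real.rpow_mul hx.le]
  norm_num

/-- The modified Bessel equation of order `1 / 3` for `x ^ (-1 / 3) * f x`, as a first-order system
in `f` and `e = x ^ (1 / 3) * f'`. -/
def BesselSystem (f e : ℝ → ℝ) : Prop :=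
  ∀ x : ℝ, 0 < x → HasDerivAt f (x ^ (-1 / 3 : ℝ) * e x) x ∧
    HasDerivAt e (x ^ (1 / 3 : ℝ) * f x) x

theorem BesselSystem.sub_smul {f e f₁ e₁ f₂ e₂ : ℝ → ℝ} (h : BesselSystem f e)
    (h₁ : BesselSystem f₁ e₁) (h₂ : BesselSystem f₂ e₂) (a b : ℝ) :
    BesselSystem (fun x => f x - (a * f₁ x + b * f₂ x)) fun x => e x - (a * e₁ x + b * e₂ x) := by
  intro x hx
  constructor
  · convert! (h x hx).1.sub (((h₁ x hx).1.const_mul a).add ((h₂ x hx).1.const_mul b)) using 1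
    ring
  · convert! (h x hx).2.sub (((h₁ x hx).2.const_mul a).add ((h₂ x hx).2.const_mul b)) using 1
    ring

theorem eq_of_hasDerivAt_zero_of_tendsto {f : ℝ → ℝ} {l : ℝ}
    (hf : ∀ x, 0 < x → HasDerivAt f 0 x) (hl : Tendsto f (𝓝[>] 0) (𝓝 l)) {x : ℝ} (hx : 0 < x) :
    f x = l := by
  refine tendsto_nhds_unique (tendsto_const_nhds.congr' ?_) hl
  filter_upwards [self_mem_nhdsWithin] with y hy
  exact isOpen_Ioi.is_const_of_deriv_eq_zero isPreconnected_Ioi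
    (fun z hz => (hf z hz).differentiableAt.differentiableWithinAt)
    (fun z hz => (hf z hz).deriv) hx hy

/-- The solution of the Bessel system that is analytic at `0`. -/
noncomputable def regularSol (x : ℝ) : ℝ := powerSum (limitCoeff (2 / 3)) (x ^ 2 / 4)

/-- The companion of `regularSol` in the Bessel system. -/
noncomputable def regularSolAux (x : ℝ) : ℝ :=
  x ^ (4 / 3 : ℝ) / 2 * powerSum (derivCoeff (limitCoeff (2 / 3))) (x ^ 2 / 4)

/-- The solution of the Bessel system with exponent `2 / 3` at `0`. -/
noncomputable def singularSol (x : ℝ) : ℝ :=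
  x ^ (2 / 3 : ℝ) * powerSum (limitCoeff (4 / 3)) (x ^ 2 / 4)

/-- The companion of `singularSol` in the Bessel system. -/
noncomputable def singularSolAux (x : ℝ) : ℝ :=
  2 / 3 * powerSum (limitCoeff (4 / 3)) (x ^ 2 / 4) +
    x ^ 2 / 2 * powerSum (derivCoeff (limitCoeff (4 / 3))) (x ^ 2 / 4)

theorem besselSystem_regularSol : BesselSystem regularSol regularSolAux := by
  intro x hx
  have he := entireCoeff_limitCoeff (a := 2 / 3) (by norm_num)
  have h1 := hasDerivAt_powerSum_sq he x
  have h2 := hasDerivAt_powerSum_sq he.derivCoeff x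
  have h3 := (Real.hasDerivAt_rpow_const (x := x) (p := 4 / 3) (Or.inl hx.ne')).div_const 2
  have hode := powerSum_limitCoeff_ode (a := 2 / 3) (by norm_num) (x ^ 2 / 4)
  obtain ⟨y, hy, rfl⟩ := exists_cube hx
  constructor
  · convert! h1 using 1
    rw [regularSolAux, rpow_third hy (-1 / 3) (-1) (by norm_num),
      rpow_third hy (4 / 3) 4 (by norm_num)]
    simp only [zpow_neg, zpow_ofNat]
    field_simp
  · convert! h3.mul h2 using 1
    rw [regularSol, ← hode, rpow_third hy (1 / 3) 1 (by norm_num),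
      rpow_third hy (4 / 3) 4 (by norm_num),
      rpow_third hy (4 / 3 - 1) 1 (by norm_num)]
    simp only [zpow_ofNat]
    ring

theorem besselSystem_singularSol : BesselSystem singularSol singularSolAux := by
  intro x hx
  have he := entireCoeff_limitCoeff (a := 4 / 3) (by norm_num)
  have h1 := hasDerivAt_powerSum_sq he x
  have h2 := hasDerivAt_powerSum_sq he.derivCoeff x
  have h3 := Real.hasDerivAt_rpow_const (x := x) (p := 2 / 3) (Or.inl hx.ne')
  have hode := powerSum_limitCoeff_ode (a := 4 / 3) (by norm_num) (x ^ 2 / 4)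
  have h4 := (h1.const_mul (2 / 3)).add (((hasDerivAt_pow 2 x).div_const 2).mul h2)
  obtain ⟨y, hy, rfl⟩ := exists_cube hx
  constructor
  · convert! h3.mul h1 using 1
    rw [singularSolAux, rpow_third hy (-1 / 3) (-1) (by norm_num),
      rpow_third hy (2 / 3) 2 (by norm_num),
      rpow_third hy (2 / 3 - 1) (-1) (by norm_num)]
    simp only [zpow_neg, zpow_ofNat]
    field_simp
  · convert! h4 using 1
    rw [singularSol, ← hode, rpow_third hy (1 / 3) 1 (by norm_num),
      rpow_third hy (2 / 3) 2 (by norm_num)]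
    simp only [zpow_ofNat]
    norm_num
    ring

theorem besselSystem_expMoment :
    BesselSystem (expMoment 0) fun x => -(x ^ (1 / 3 : ℝ) * expMoment 1 x) := by
  intro x hx
  have h1 := hasDerivAt_expMoment 0 hx
  have h2 := hasDerivAt_expMoment 1 hx
  have h3 := Real.hasDerivAt_rpow_const (x := x) (p := 1 / 3) (Or.inl hx.ne')
  have h4 := expMoment_by_parts 0 hx
  have h5 := (h3.mul h2).neg
  norm_num at h1 h4
  obtain ⟨y, hy, rfl⟩ := exists_cube hx
  constructor
  · convert! h1 using 1
    beta_reduce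
    rw [rpow_third hy (-1 / 3) (-1) (by norm_num), rpow_third hy (1 / 3) 1 (by norm_num)]
    simp only [zpow_neg, zpow_ofNat]
    field_simp
  · convert! h5 using 1
    rw [rpow_third hy (1 / 3) 1 (by norm_num), rpow_third hy (1 / 3 - 1) (-2) (by norm_num)]
    simp only [zpow_neg, zpow_ofNat]
    field_simp
    linear_combination 3 * h4

theorem tendsto_regularSol : Tendsto regularSol (𝓝[>] 0) (𝓝 1) := by
  have h := (continuous_powerSum_sq (entireCoeff_limitCoeff (a := 2 / 3) (by norm_num))).tendsto 0
  norm_num [powerSum_zero, limitCoeff, risingFactorial] at h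
  exact h.mono_left nhdsWithin_le_nhds

theorem tendsto_regularSolAux : Tendsto regularSolAux (𝓝[>] 0) (𝓝 0) := by
  have hc : Continuous regularSolAux :=
    ((Real.continuous_rpow_const (by norm_num)).div_const 2).mul
      (continuous_powerSum_sq (entireCoeff_limitCoeff (by norm_num)).derivCoeff)
  have h := hc.tendsto 0
  rw [show regularSolAux 0 = 0 by norm_num [regularSolAux]] at h
  exact h.mono_left nhdsWithin_le_nhds

theorem tendsto_singularSol : Tendsto singularSol (𝓝[>] 0) (𝓝 0) := by
  have hc : Continuous singularSol :=
    (Real.continuous_rpow_const (by norm_num)).mul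
      (continuous_powerSum_sq (entireCoeff_limitCoeff (by norm_num)))
  have h := hc.tendsto 0
  rw [show singularSol 0 = 0 by norm_num [singularSol]] at h
  exact h.mono_left nhdsWithin_le_nhds

theorem tendsto_singularSolAux : Tendsto singularSolAux (𝓝[>] 0) (𝓝 (2 / 3)) := by
  have he := entireCoeff_limitCoeff (a := 4 / 3) (by norm_num)
  have hc : Continuous singularSolAux :=
    ((continuous_powerSum_sq he).const_mul (2 / 3)).add
      (Continuous.mul (by fun_prop) (continuous_powerSum_sq he.derivCoeff))
  have h := hc.tendsto 0
  rw [show singularSolAux 0 = 2 / 3 by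
    norm_num [singularSolAux, powerSum_zero, limitCoeff, risingFactorial]] at h
  exact h.mono_left nhdsWithin_le_nhds

theorem regularSol_pos (x : ℝ) : 0 < regularSol x :=
  zero_lt_one.trans_le (one_le_powerSum_limitCoeff (by norm_num) (by positivity))

/-- A solution of the Bessel system that vanishes at `0` is zero. -/
theorem BesselSystem.eq_zero {f e : ℝ → ℝ} (h : BesselSystem f e)
    (hf : Tendsto f (𝓝[>] 0) (𝓝 0)) (he : Tendsto e (𝓝[>] 0) (𝓝 0)) {x : ℝ} (hx : 0 < x) :
    f x = 0 ∧ e x = 0 := by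
  have hW : ∀ x, 0 < x → e x * regularSol x - f x * regularSolAux x = 0 := by
    intro x hx
    refine eq_of_hasDerivAt_zero_of_tendsto
      (f := fun x => e x * regularSol x - f x * regularSolAux x) (fun x hx => ?_) ?_ hx
    · obtain ⟨h1, h2⟩ := h x hx
      obtain ⟨h3, h4⟩ := besselSystem_regularSol x hx
      convert! (h2.mul h3).sub (h1.mul h4) using 1
      ring
    · simpa using (he.mul tendsto_regularSol).sub (hf.mul tendsto_regularSolAux)
  have hq : f x / regularSol x = 0 := by
    refine eq_of_hasDerivAt_zero_of_tendsto (f := fun x => f x / regularSol x)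
      (fun x hx => ?_) ?_ hx
    · obtain ⟨h1, -⟩ := h x hx
      obtain ⟨h3, -⟩ := besselSystem_regularSol x hx
      convert! h1.div h3 (regularSol_pos x).ne' using 1
      have := hW x hx
      rw [eq_comm, div_eq_zero_iff]
      left
      linear_combination x ^ (-1 / 3 : ℝ) * this
    · have := hf.div tendsto_regularSol one_ne_zero
      rwa [zero_div] at this
  have hf0 : f x = 0 := by
    simpa [(regularSol_pos x).ne'] using hq
  refine ⟨hf0, ?_⟩
  have := hW x hx
  rw [hf0, zero_mul, sub_zero] at this
  simpa [(regularSol_pos x).ne'] using this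

theorem expMoment_eq_series {x : ℝ} (hx : 0 < x) :
    expMoment 0 x = (∫ t in Ioi (1 : ℝ), (t ^ 2 - 1) ^ (-5 / 6 : ℝ)) * regularSol x +
        -(3 / 2) * Real.Gamma (1 / 3) * singularSol x ∧
      -(x ^ (1 / 3 : ℝ) * expMoment 1 x) =
        (∫ t in Ioi (1 : ℝ), (t ^ 2 - 1) ^ (-5 / 6 : ℝ)) * regularSolAux x +
        -(3 / 2) * Real.Gamma (1 / 3) * singularSolAux x := by
  set A := ∫ t in Ioi (1 : ℝ), (t ^ 2 - 1) ^ (-5 / 6 : ℝ) with hA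
  have h := (besselSystem_expMoment.sub_smul besselSystem_regularSol besselSystem_singularSol A
    (-(3 / 2) * Real.Gamma (1 / 3))).eq_zero ?_ ?_ hx
  · exact ⟨sub_eq_zero.1 h.1, sub_eq_zero.1 h.2⟩
  · have := tendsto_expMoment_zero.sub ((tendsto_regularSol.const_mul A).add
      (tendsto_singularSol.const_mul (-(3 / 2) * Real.Gamma (1 / 3))))
    simpa [hA] using this
  · have := tendsto_rpow_mul_expMoment_one.neg.sub ((tendsto_regularSolAux.const_mul A).add
      (tendsto_singularSolAux.const_mul (-(3 / 2) * Real.Gamma (1 / 3))))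
    convert! this using 2
    ring

theorem besselK_five_thirds {x : ℝ} (hx : 0 < x) :
    besselK (5 / 3) x = √Real.pi / Real.Gamma (13 / 6) * (1 / 2) ^ (5 / 3 : ℝ) * (7 / 9) *
      (x ^ (-1 / 3 : ℝ) * expMoment 0 x + 4 / 3 * (x ^ (-4 / 3 : ℝ) * expMoment 1 x)) := by
  have hI : ∫ t in Ioi (1 : ℝ), Real.exp (-x * t) * (t ^ 2 - 1) ^ (5 / 3 - 1 / 2 : ℝ) =
      expMoment 4 x - 2 * expMoment 2 x + expMoment 0 x := by
    have hi := fun k => integrableOn_moment k hx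
    rw [expMoment, expMoment, expMoment, ← integral_const_mul,
      ← integral_sub (hi 4) ((hi 2).const_mul 2),
      ← integral_add (by exact (hi 4).sub ((hi 2).const_mul 2)) (hi 0)]
    refine setIntegral_congr_fun measurableSet_Ioi fun t ht => ?_
    have hpos := sq_sub_one_pos ht
    have e : (t ^ 2 - 1) ^ (5 / 3 - 1 / 2 : ℝ) =
        (t ^ 2 - 1) ^ 2 * (t ^ 2 - 1) ^ (-5 / 6 : ℝ) := by
      rw [← Real.rpow_natCast (t ^ 2 - 1) 2, ← Real.rpow_add hpos]; norm_num
    simp only [e]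
    ring
  have h0 := expMoment_by_parts 0 hx
  have h1 := expMoment_by_parts 1 hx
  have h2 := expMoment_by_parts 2 hx
  norm_num at h0 h1 h2
  have hJ : x ^ 3 * (expMoment 4 x - 2 * expMoment 2 x + expMoment 0 x) =
      7 / 9 * (x * expMoment 0 x + 4 / 3 * expMoment 1 x) := by
    linear_combination -x ^ 2 * h2 + x ^ 2 * h0 - 7 / 3 * x * h1 - 28 / 9 * h0
  rw [besselK, hI, show (5 / 3 + 1 / 2 : ℝ) = 13 / 6 by norm_num, div_eq_mul_one_div x,
    Real.mul_rpow hx.le (by norm_num)]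
  obtain ⟨y, hy, rfl⟩ := exists_cube hx
  rw [rpow_third hy (5 / 3) 5 (by norm_num), rpow_third hy (-1 / 3) (-1) (by norm_num),
    rpow_third hy (-4 / 3) (-4) (by norm_num)]
  simp only [zpow_neg, zpow_ofNat]
  generalize (1 / 2 : ℝ) ^ (5 / 3 : ℝ) = c
  have hJ' : expMoment 4 (y ^ 3) - 2 * expMoment 2 (y ^ 3) + expMoment 0 (y ^ 3) =
      7 / 9 * (y ^ 3 * expMoment 0 (y ^ 3) + 4 / 3 * expMoment 1 (y ^ 3)) / (y ^ 3) ^ 3 := by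
    rw [eq_div_iff (by positivity)]
    linarith
  rw [hJ']
  field_simp

/-- The primitive of `x ^ (-1 / 3) * expMoment 0 x` that vanishes at `0`. -/
noncomputable def momentPrimitive (x : ℝ) : ℝ :=
  (∫ t in Ioi (1 : ℝ), (t ^ 2 - 1) ^ (-5 / 6 : ℝ)) *
      (x ^ (2 / 3 : ℝ) * powerSum (primCoeff (limitCoeff (2 / 3)) (1 / 3)) (x ^ 2 / 4) / 2) +
    -(3 / 2) * Real.Gamma (1 / 3) *
      (x ^ (4 / 3 : ℝ) * powerSum (primCoeff (limitCoeff (4 / 3)) (2 / 3)) (x ^ 2 / 4) / 2)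

theorem hasDerivAt_momentPrimitive {x : ℝ} (hx : 0 < x) :
    HasDerivAt momentPrimitive (x ^ (-1 / 3 : ℝ) * expMoment 0 x) x := by
  have he₁ := entireCoeff_limitCoeff (a := 2 / 3) (by norm_num)
  have he₂ := entireCoeff_limitCoeff (a := 4 / 3) (by norm_num)
  have h1 := hasDerivAt_powerSum_sq (he₁.primCoeff (c := 1 / 3) (by norm_num)) x
  have h2 := hasDerivAt_powerSum_sq (he₂.primCoeff (c := 2 / 3) (by norm_num)) x
  have h3 := Real.hasDerivAt_rpow_const (x := x) (p := 2 / 3) (Or.inl hx.ne')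
  have h4 := Real.hasDerivAt_rpow_const (x := x) (p := 4 / 3) (Or.inl hx.ne')
  have p1 := powerSum_primCoeff he₁ (c := 1 / 3) (by norm_num) (x ^ 2 / 4)
  have p2 := powerSum_primCoeff he₂ (c := 2 / 3) (by norm_num) (x ^ 2 / 4)
  convert! (((h3.mul h1).div_const 2).const_mul
    (∫ t in Ioi (1 : ℝ), (t ^ 2 - 1) ^ (-5 / 6 : ℝ))).add (((h4.mul h2).div_const 2).const_mul
    (-(3 / 2) * Real.Gamma (1 / 3))) using 1
  rw [(expMoment_eq_series hx).1, regularSol, singularSol, ← p1, ← p2]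
  obtain ⟨y, hy, rfl⟩ := exists_cube hx
  rw [rpow_third hy (-1 / 3) (-1) (by norm_num), rpow_third hy (2 / 3) 2 (by norm_num),
    rpow_third hy (4 / 3) 4 (by norm_num), rpow_third hy (2 / 3 - 1) (-1) (by norm_num),
    rpow_third hy (4 / 3 - 1) 1 (by norm_num)]
  simp only [zpow_neg, zpow_ofNat]
  field_simp
  ring

theorem tendsto_momentPrimitive :
    Tendsto momentPrimitive atTop (𝓝 (∫ u in Ioi (0 : ℝ), u ^ (-1 / 3 : ℝ) * expMoment 0 u)) := by
  refine (intervalIntegral_tendsto_integral_Ioi 0 integrableOn_rpow_mul_expMoment tendsto_id).congr'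
    ?_
  have he₁ := entireCoeff_limitCoeff (a := 2 / 3) (by norm_num)
  have he₂ := entireCoeff_limitCoeff (a := 4 / 3) (by norm_num)
  have hc : Continuous momentPrimitive :=
    ((((Real.continuous_rpow_const (by norm_num)).mul
      (continuous_powerSum_sq (he₁.primCoeff (by norm_num)))).div_const 2).const_mul _).add
    ((((Real.continuous_rpow_const (by norm_num)).mul
      (continuous_powerSum_sq (he₂.primCoeff (by norm_num)))).div_const 2).const_mul _)
  filter_upwards [eventually_ge_atTop 0] with x hx
  rw [id, intervalIntegral.integral_eq_sub_of_hasDerivAt_of_le hx hc.continuousOn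
    (fun t ht => hasDerivAt_momentPrimitive ht.1)]
  · norm_num [momentPrimitive]
  · rw [intervalIntegrable_iff_integrableOn_Ioc_of_le hx]
    exact integrableOn_rpow_mul_expMoment.mono_set Ioc_subset_Ioi_self

theorem tendsto_rpow_neg_third_mul_expMoment_one :
    Tendsto (fun t => t ^ (-1 / 3 : ℝ) * expMoment 1 t) atTop (𝓝 0) := by
  set A := ∫ t in Ioi (1 : ℝ), (t ^ 2 - 1) ^ (-5 / 6 : ℝ) with hA
  have h : Tendsto (fun t : ℝ => t⁻¹ * A) atTop (𝓝 0) := by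
    simpa using tendsto_inv_atTop_zero.mul_const A
  refine tendsto_of_tendsto_of_tendsto_of_le_of_le' tendsto_const_nhds h ?_ ?_
  · filter_upwards [eventually_gt_atTop 0] with t ht
    exact mul_nonneg (by positivity) (expMoment_nonneg 1 t)
  · filter_upwards [eventually_ge_atTop 1] with t ht
    have h1 := expMoment_le 1 (zero_lt_one.trans_le ht)
    simp only [Nat.factorial_one, Nat.cast_one, pow_one, one_div] at h1
    refine le_trans (mul_le_of_le_one_left (expMoment_nonneg 1 t) ?_) h1
    exact Real.rpow_le_one_of_one_le_of_nonpos ht (by norm_num)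

theorem besselK_nonneg {ν x : ℝ} (hν : -1 / 2 < ν) (hx : 0 < x) : 0 ≤ besselK ν x := by
  have h1 : 0 < Real.Gamma (ν + 1 / 2) := Real.Gamma_pos_of_pos (by linarith)
  have h2 : 0 ≤ ∫ t in Ioi (1 : ℝ), Real.exp (-x * t) * (t ^ 2 - 1) ^ (ν - 1 / 2) :=
    setIntegral_nonneg measurableSet_Ioi fun t ht => by
      have := (sq_sub_one_pos ht).le
      positivity
  rw [besselK]
  positivity

theorem integral_besselK {x : ℝ} (hx : 0 < x) :
    ∫ t in Ioi x, besselK (5 / 3) t =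
      √Real.pi / Real.Gamma (13 / 6) * (1 / 2) ^ (5 / 3 : ℝ) * (7 / 9) *
        (2 * (x ^ (-1 / 3 : ℝ) * expMoment 1 x) + momentPrimitive x -
          ∫ u in Ioi (0 : ℝ), u ^ (-1 / 3 : ℝ) * expMoment 0 u) := by
  set c := √Real.pi / Real.Gamma (13 / 6) * (1 / 2) ^ (5 / 3 : ℝ) * (7 / 9) with hc
  have hd : ∀ t ∈ Ici x, HasDerivAt
      (fun t => c * (-2 * (t ^ (-1 / 3 : ℝ) * expMoment 1 t) - momentPrimitive t))
      (besselK (5 / 3) t) t := by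
    intro t ht
    have ht0 : 0 < t := hx.trans_le ht
    have h1 := (Real.hasDerivAt_rpow_const (x := t) (p := -1 / 3) (Or.inl ht0.ne')).mul
      (hasDerivAt_expMoment 1 ht0)
    convert! ((h1.const_mul (-2)).sub (hasDerivAt_momentPrimitive ht0)).const_mul c using 1
    have h4 := expMoment_by_parts 0 ht0
    norm_num at h4
    rw [besselK_five_thirds ht0, ← hc]
    obtain ⟨y, hy, rfl⟩ := exists_cube ht0
    rw [rpow_third hy (-1 / 3) (-1) (by norm_num), rpow_third hy (-4 / 3) (-4) (by norm_num),
      rpow_third hy (-1 / 3 - 1) (-4) (by norm_num)]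
    simp only [zpow_neg, zpow_ofNat]
    refine congrArg (c * ·) ?_
    field_simp
    norm_num
    linear_combination 6 * h4
  have hl := ((tendsto_rpow_neg_third_mul_expMoment_one.const_mul (-2)).sub
    tendsto_momentPrimitive).const_mul c
  rw [integral_Ioi_of_hasDerivAt_of_nonneg' hd
    (fun t ht => besselK_nonneg (by norm_num) (hx.trans ht)) hl]
  ring

theorem primitive_eq_series {x : ℝ} (hx : 0 < x) :
    2 * (x ^ (-1 / 3 : ℝ) * expMoment 1 x) + momentPrimitive x =
      (∫ t in Ioi (1 : ℝ), (t ^ 2 - 1) ^ (-5 / 6 : ℝ)) *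
          (x ^ (2 / 3 : ℝ) * (-(27 / 80) * (x ^ 2 / 4 * powerSum secondCoeff (x ^ 2 / 4)))) +
        -(3 / 2) * Real.Gamma (1 / 3) *
          (x ^ (-2 / 3 : ℝ) * (-(4 / 3) * powerSum firstCoeff (x ^ 2 / 4))) := by
  have h := (expMoment_eq_series hx).2
  rw [powerSum_firstCoeff, powerSum_secondCoeff, momentPrimitive]
  rw [regularSolAux, singularSolAux] at h
  obtain ⟨y, hy, rfl⟩ := exists_cube hx
  rw [rpow_third hy (1 / 3) 1 (by norm_num), rpow_third hy (4 / 3) 4 (by norm_num)] at h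
  rw [rpow_third hy (-1 / 3) (-1) (by norm_num), rpow_third hy (2 / 3) 2 (by norm_num),
    rpow_third hy (-2 / 3) (-2) (by norm_num), rpow_third hy (4 / 3) 4 (by norm_num)]
  simp only [zpow_neg, zpow_ofNat, pow_one] at h ⊢
  field_simp
  field_simp at h
  linear_combination -8 * h

theorem integral_weight :
    ∫ t in Ioi (1 : ℝ), (t ^ 2 - 1) ^ (-5 / 6 : ℝ) =
      Real.Gamma (1 / 3) * Real.Gamma (1 / 6) / (2 * √Real.pi) := by
  have h := integral_Ioi_one_beta (p := 0) (v := 1 / 6) (by norm_num) (by norm_num)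
  norm_num [Real.Gamma_one_half_eq] at h ⊢
  exact h

theorem integral_rpow_mul_expMoment_eq_Gamma :
    ∫ u in Ioi (0 : ℝ), u ^ (-1 / 3 : ℝ) * expMoment 0 u =
      Real.Gamma (2 / 3) * (Real.Gamma (2 / 3) * Real.Gamma (1 / 6) /
        (2 * Real.Gamma (5 / 6))) := by
  rw [integral_rpow_mul_expMoment, integral_Ioi_one_beta (by norm_num) (by norm_num)]
  norm_num

theorem Gamma_thirteen_sixths : Real.Gamma (13 / 6) = 7 / 36 * Real.Gamma (1 / 6) := by
  rw [show (13 / 6 : ℝ) = 7 / 6 + 1 by norm_num, Real.Gamma_add_one (by norm_num),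
    show (7 / 6 : ℝ) = 1 / 6 + 1 by norm_num, Real.Gamma_add_one (by norm_num)]
  ring

theorem Gamma_neg_eight_thirds : Real.Gamma (-8 / 3) = -(27 / 80) * Real.Gamma (1 / 3) := by
  have h1 := Real.Gamma_add_one (s := -8 / 3) (by norm_num)
  have h2 := Real.Gamma_add_one (s := -5 / 3) (by norm_num)
  have h3 := Real.Gamma_add_one (s := -2 / 3) (by norm_num)
  norm_num at h1 h2 h3 ⊢
  rw [h3, h2, h1]
  ring

theorem two_rpow_third (n : ℤ) : (2 : ℝ) ^ (n / 3 : ℝ) = (2 ^ (1 / 3 : ℝ)) ^ n := by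
  rw [← Real.rpow_intCast, ← Real.rpow_mul (by norm_num)]
  ring_nf

theorem two_rpow_third_pow : ((2 : ℝ) ^ (1 / 3 : ℝ)) ^ 3 = 2 := by
  rw [← Real.rpow_natCast, ← Real.rpow_mul (by norm_num)]
  norm_num

theorem half_rpow : (1 / 2 : ℝ) ^ (5 / 3 : ℝ) = 2 ^ (1 / 3 : ℝ) / 4 := by
  rw [one_div, Real.inv_rpow (by norm_num), ← Real.rpow_neg (by norm_num),
    show (-(5 / 3) : ℝ) = 1 / 3 - 2 by norm_num, Real.rpow_sub (by norm_num)]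
  norm_num

theorem besselK_const :
    √Real.pi / Real.Gamma (13 / 6) * (1 / 2) ^ (5 / 3 : ℝ) * (7 / 9) =
      2 ^ (1 / 3 : ℝ) * √Real.pi / Real.Gamma (1 / 6) := by
  have := Real.Gamma_pos_of_pos (s := 1 / 6) (by norm_num)
  rw [Gamma_thirteen_sixths, half_rpow]
  field_simp
  norm_num

theorem Gamma_sixth_mul : Real.Gamma (1 / 6) * Real.Gamma (2 / 3) =
    Real.Gamma (1 / 3) * (2 ^ (1 / 3 : ℝ)) ^ 2 * √Real.pi := by
  have h := Real.Gamma_mul_Gamma_add_half (1 / 6)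
  have e := two_rpow_third 2
  norm_num at h e ⊢
  rw [h, e]

theorem Gamma_third_mul : Real.Gamma (1 / 3) * Real.Gamma (5 / 6) =
    Real.Gamma (2 / 3) * 2 ^ (1 / 3 : ℝ) * √Real.pi := by
  have h := Real.Gamma_mul_Gamma_add_half (1 / 3)
  norm_num at h ⊢
  exact h

theorem Gamma_third_mul_Gamma_two_thirds :
    Real.Gamma (1 / 3) * Real.Gamma (2 / 3) = 2 * (Real.pi / √3) := by
  have h := Real.Gamma_mul_Gamma_one_sub (1 / 3)
  rw [show Real.pi * (1 / 3) = Real.pi / 3 by ring, Real.sin_pi_div_three] at h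
  rw [show (2 / 3 : ℝ) = 1 - 1 / 3 by norm_num, h]
  field_simp

theorem synchrotronF_eq_powerSum {x : ℝ} (hx : 0 < x) :
    synchrotronF x =
      -(Real.pi / √3) * x +
      (4 * x) ^ (1 / 3 : ℝ) * Real.Gamma (2 / 3) * powerSum firstCoeff (x ^ 2 / 4) +
      (x ^ 11 / 256) ^ (1 / 3 : ℝ) * Real.Gamma (-8 / 3) * powerSum secondCoeff (x ^ 2 / 4) := by
  have h1 := Gamma_sixth_mul
  have h2 := Gamma_third_mul
  have h3 := Gamma_third_mul_Gamma_two_thirds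
  have hr := two_rpow_third_pow
  have hG₁ := Real.Gamma_pos_of_pos (s := 1 / 6) (by norm_num)
  have hG₂ := Real.Gamma_pos_of_pos (s := 5 / 6) (by norm_num)
  have hπ : 0 < √Real.pi := Real.sqrt_pos.2 Real.pi_pos
  have e4 : (4 * x) ^ (1 / 3 : ℝ) = (2 ^ (1 / 3 : ℝ)) ^ 2 * x ^ (1 / 3 : ℝ) := by
    rw [Real.mul_rpow (by norm_num) hx.le, show (4 : ℝ) = 2 ^ 2 by norm_num, ← Real.rpow_pow_comm
      (by norm_num)]
  have e256 : (x ^ 11 / 256) ^ (1 / 3 : ℝ) =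
      (x ^ (1 / 3 : ℝ)) ^ 11 / (2 ^ (1 / 3 : ℝ)) ^ 8 := by
    rw [Real.div_rpow (by positivity) (by norm_num), show (256 : ℝ) = 2 ^ 8 by norm_num,
      ← Real.rpow_pow_comm hx.le, ← Real.rpow_pow_comm (by norm_num)]
  rw [synchrotronF, integral_besselK hx, primitive_eq_series hx, integral_weight,
    integral_rpow_mul_expMoment_eq_Gamma, besselK_const, Gamma_neg_eight_thirds, e4, e256]
  generalize powerSum firstCoeff (x ^ 2 / 4) = S₁
  generalize powerSum secondCoeff (x ^ 2 / 4) = S₂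
  obtain ⟨y, hy, rfl⟩ := exists_cube hx
  rw [rpow_third hy (2 / 3) 2 (by norm_num), rpow_third hy (-2 / 3) (-2) (by norm_num),
    rpow_third hy (1 / 3) 1 (by norm_num)]
  simp only [zpow_neg, zpow_ofNat]
  have hr0 : 0 < (2 : ℝ) ^ (1 / 3 : ℝ) := by positivity
  generalize (2 : ℝ) ^ (1 / 3 : ℝ) = r at *
  generalize Real.Gamma (1 / 6) = G₁ at *
  generalize Real.Gamma (5 / 6) = G₂ at *
  generalize Real.Gamma (1 / 3) = G₃ at *
  generalize Real.Gamma (2 / 3) = G₄ at *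
  generalize √Real.pi = q at *
  generalize Real.pi / √3 = P at *
  have k0 : r * q / G₁ * (G₄ * (G₄ * G₁ / (2 * G₂))) = P := by
    field_simp
    linear_combination G₂ * h3 - G₄ * h2
  have k1 : r * q / G₁ * (2 * G₃) = r ^ 2 * G₄ := by
    field_simp
    linear_combination -r * h1 - G₃ * q * hr
  have k2 : r * q / G₁ * (G₃ * G₁ / (2 * q)) = 4 * G₃ / r ^ 8 := by
    field_simp
    linear_combination G₃ * (r ^ 6 + 2 * r ^ 3 + 4) * hr
  have k1' : y ^ 3 * (y ^ 2)⁻¹ = y := by field_simp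
  linear_combination -y ^ 3 * k0 + y * S₁ * k1 + y ^ 11 * (-(27 / 320)) * S₂ * k2 +
    r * q / G₁ * (2 * G₃) * S₁ * k1'

end ClosedForm

/-- For every x > 0, the synchrotron function satisfies the closed analytic
formula in terms of two absolutely convergent hypergeometric series. -/
theorem synchrotronF_closed_form (x : ℝ) (hx : 0 < x) :
    Summable (fun n : ℕ =>
      |risingFactorial (-1/3) n /
        (risingFactorial (-2/3) n * risingFactorial (2/3) n * n.factorial) * (x^2/4)^n|) ∧
    Summable (fun n : ℕ =>
      |risingFactorial (4/3) n /
        (risingFactorial (8/3) n * risingFactorial (7/3) n * n.factorial) * (x^2/4)^n|) ∧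
    synchrotronF x =
      -(Real.pi / Real.sqrt 3) * x +
      (4*x) ^ ((1:ℝ)/3) * Real.Gamma (2/3) *
        (∑' n : ℕ, risingFactorial (-1/3) n /
          (risingFactorial (-2/3) n * risingFactorial (2/3) n * n.factorial) * (x^2/4)^n) +
      (x^11 / 256) ^ ((1:ℝ)/3) * Real.Gamma (-8/3) *
        (∑' n : ℕ, risingFactorial (4/3) n /
          (risingFactorial (8/3) n * risingFactorial (7/3) n * n.factorial) * (x^2/4)^n) := by
  exact ⟨entireCoeff_firstCoeff _, entireCoeff_secondCoeff _, synchrotronF_eq_powerSum hx⟩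
end

section
/- As x → 0 from the right, the synchrotron function satisfies F(x) − 2^{2/3} Γ(2/3) x^{1/3} + (π/√3) x − (3 Γ(2/3) / 4^{5/3}) x^{7/3} = O( x^{11/3} ). -/
open Filter Asymptotics

open MeasureTheory Set Real in
lemma integrableOn_besselProfile :
    IntegrableOn (fun σ : ℝ => 7/6 * σ ^ ((1:ℝ)/3) - σ ^ ((7:ℝ)/3)
      + (max (σ^2 - 1) 0) ^ ((7:ℝ)/6)) (Ioi 0) := by
  have hc : Continuous (fun σ : ℝ => 7/6 * σ ^ ((1:ℝ)/3) - σ ^ ((7:ℝ)/3)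
      + (max (σ^2 - 1) 0) ^ ((7:ℝ)/6)) := by
    refine ((continuous_const.mul (continuous_id.rpow_const ?_)).sub
      (continuous_id.rpow_const ?_)).add (Continuous.rpow_const (by fun_prop) ?_)
    all_goals intro x; right; norm_num
  rw [← Ioc_union_Ioi_eq_Ioi (zero_le_one (α := ℝ))]
  refine IntegrableOn.union ?_ ?_
  · exact (hc.integrableOn_Icc (a := 0) (b := 1)).mono_set Ioc_subset_Icc_self
  · refine Integrable.mono' (integrableOn_Ioi_rpow_of_lt (a := -5/3) (by norm_num) one_pos)
      hc.aestronglyMeasurable ?_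
    filter_upwards [ae_restrict_mem measurableSet_Ioi] with σ (hσ : 1 < σ)
    have h0 : 0 < σ := by linarith
    set v : ℝ := (σ^2)⁻¹ with hv
    have hv0 : 0 < v := by positivity
    have hv1 : v < 1 := inv_lt_one_of_one_lt₀ (by nlinarith)
    have e1 : (max (σ^2 - 1) 0) ^ ((7:ℝ)/6) = σ ^ ((7:ℝ)/3) * (1 - v) ^ ((7:ℝ)/6) := by
      rw [max_eq_left (by nlinarith)]
      have : σ^2 - 1 = σ^2 * (1 - v) := by rw [hv]; field_simp
      rw [this, mul_rpow (by positivity) (by linarith), ← rpow_natCast σ 2, ← rpow_mul h0.le]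
      norm_num
    have e2 : σ ^ ((1:ℝ)/3) = σ ^ ((7:ℝ)/3) * v := by
      rw [hv, ← rpow_natCast σ 2, ← rpow_neg h0.le, ← rpow_add h0]; norm_num
    have e3 : σ ^ ((-5:ℝ)/3) = σ ^ ((7:ℝ)/3) * v ^ 2 := by
      rw [hv, ← rpow_natCast σ 2, ← rpow_neg h0.le, ← rpow_natCast, ← rpow_mul h0.le,
        ← rpow_add h0]; norm_num
    have lo := one_add_mul_self_le_rpow_one_add (s := -v) (by linarith) (p := 7/6) (by norm_num)
    have hi := rpow_one_add_le_one_add_mul_self (s := -v) (by linarith) (p := 1/6)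
      (by norm_num) (by norm_num)
    rw [← sub_eq_add_neg] at lo hi
    have e4 : (1 - v) ^ ((7:ℝ)/6) = (1 - v) * (1 - v) ^ ((1:ℝ)/6) := by
      rw [show (7:ℝ)/6 = 1 + 1/6 by norm_num, rpow_add (by linarith), rpow_one]
    have hi' : (1 - v) ^ ((7:ℝ)/6) ≤ (1 - v) * (1 + 1/6 * -v) := by
      rw [e4]; exact mul_le_mul_of_nonneg_left hi (by linarith)
    rw [e1, e2, e3]
    have hp : 0 < σ ^ ((7:ℝ)/3) := by positivity
    have : 7/6 * (σ ^ ((7:ℝ)/3) * v) - σ ^ ((7:ℝ)/3) + σ ^ ((7:ℝ)/3) * (1 - v) ^ ((7:ℝ)/6)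
      = σ ^ ((7:ℝ)/3) * ((1 - v) ^ ((7:ℝ)/6) - (1 + 7/6 * -v)) := by ring
    rw [this, Real.norm_of_nonneg (mul_nonneg hp.le (by linarith))]
    exact mul_le_mul_of_nonneg_left (by nlinarith) hp.le

open MeasureTheory Set Real in
lemma integral_rpow_mul_one_sub_rpow {a b : ℝ} (ha : 0 < a) (hb : 0 < b) :
    IntervalIntegrable (fun x : ℝ => x ^ (a - 1) * (1 - x) ^ (b - 1)) volume 0 1 ∧
    ∫ x in (0:ℝ)..1, x ^ (a - 1) * (1 - x) ^ (b - 1) = Gamma a * Gamma b / Gamma (a + b) := by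
  have key : ∀ x ∈ Ioc (0:ℝ) 1, (x:ℂ) ^ ((a:ℂ) - 1) * (1 - (x:ℂ)) ^ ((b:ℂ) - 1)
      = ((x ^ (a - 1) * (1 - x) ^ (b - 1) : ℝ) : ℂ) := by
    intro x hx
    rw [Complex.ofReal_mul, Complex.ofReal_cpow hx.1.le, Complex.ofReal_cpow (by linarith [hx.2])]
    push_cast; rfl
  have hi := Complex.betaIntegral_convergent (u := a) (v := b) (by simpa) (by simpa)
  have hi' : IntervalIntegrable (fun x : ℝ => ((x ^ (a - 1) * (1 - x) ^ (b - 1) : ℝ) : ℂ))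
      volume 0 1 := hi.congr (by rw [uIoc_of_le zero_le_one]; exact key)
  constructor
  · rw [intervalIntegrable_iff] at hi' ⊢
    have := Integrable.re hi'
    simpa [IntegrableOn] using this
  · have h1 := ProbabilityTheory.beta_eq_betaIntegralReal a b ha hb
    rw [ProbabilityTheory.beta] at h1
    rw [h1, Complex.betaIntegral, intervalIntegral.integral_congr_uIoo
      (g := fun x : ℝ => ((x ^ (a - 1) * (1 - x) ^ (b - 1) : ℝ) : ℂ)),
      intervalIntegral.integral_ofReal, Complex.ofReal_re]
    intro x hx
    rw [uIoo_of_le zero_le_one] at hx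
    exact key x ⟨hx.1, hx.2.le⟩

open MeasureTheory Set Real in
lemma integral_regularizedBeta :
    IntegrableOn (fun v : ℝ => v ^ ((-4:ℝ)/3) * (1 - (max (1 - v) 0) ^ ((7:ℝ)/6))) (Ioi 0) ∧
    ∫ v in Ioi (0:ℝ), v ^ ((-4:ℝ)/3) * (1 - (max (1 - v) 0) ^ ((7:ℝ)/6))
      = 7/2 * (Gamma (2/3) * Gamma (7/6) / Gamma (11/6)) := by
  set q : ℝ → ℝ := fun v => v ^ ((-4:ℝ)/3) * (1 - (max (1 - v) 0) ^ ((7:ℝ)/6)) with hq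
  have hqm : Measurable q := by fun_prop
  have b1 : ∀ v ∈ Ioc (0:ℝ) 1, 0 ≤ 1 - (1 - v) ^ ((7:ℝ)/6) ∧
      1 - (1 - v) ^ ((7:ℝ)/6) ≤ 7/6 * v := by
    intro v hv
    have lo := one_add_mul_self_le_rpow_one_add (s := -v) (by linarith [hv.2]) (p := 7/6)
      (by norm_num)
    have hi := rpow_le_one (x := 1 - v) (by linarith [hv.2]) (by linarith [hv.1])
      (z := 7/6) (by norm_num)
    rw [← sub_eq_add_neg] at lo
    constructor <;> linarith
  have i1 : IntegrableOn q (Ioc 0 1) := by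
    have := (intervalIntegral.intervalIntegrable_rpow' (a := 0) (b := 1) (r := -1/3)
      (by norm_num)).const_mul (7/6)
    rw [intervalIntegrable_iff_integrableOn_Ioc_of_le zero_le_one] at this
    refine Integrable.mono' this hqm.aestronglyMeasurable ?_
    filter_upwards [ae_restrict_mem measurableSet_Ioc] with v hv
    have hp : 0 < v ^ ((-4:ℝ)/3) := rpow_pos_of_pos hv.1 _
    have e : v ^ ((-1:ℝ)/3) = v ^ ((-4:ℝ)/3) * v := by
      nth_rw 3 [← rpow_one v]; rw [← rpow_add hv.1]; norm_num
    rw [hq]; dsimp only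
    rw [max_eq_left (by linarith [hv.2]),
      Real.norm_of_nonneg (mul_nonneg hp.le (b1 v hv).1), e]
    nlinarith [mul_le_mul_of_nonneg_left (b1 v hv).2 hp.le]
  have c2 : EqOn q (fun v => v ^ ((-4:ℝ)/3)) (Ioi 1) := by
    intro v (hv : 1 < v)
    rw [hq]; dsimp only
    rw [max_eq_right (by linarith), zero_rpow (by norm_num)]; ring
  have i2 : IntegrableOn q (Ioi 1) :=
    (integrableOn_Ioi_rpow_of_lt (by norm_num) one_pos).congr_fun c2.symm measurableSet_Ioi
  obtain ⟨ib, vb⟩ := integral_rpow_mul_one_sub_rpow (a := 2/3) (b := 7/6)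
    (by norm_num) (by norm_num)
  norm_num at ib vb
  have hd : Disjoint (Ioc (0:ℝ) 1) (Ioi 1) := Ioc_disjoint_Ioi le_rfl
  rw [← Ioc_union_Ioi_eq_Ioi (zero_le_one (α := ℝ))]
  refine ⟨i1.union i2, ?_⟩
  rw [setIntegral_union hd measurableSet_Ioi i1 i2,
    setIntegral_congr_fun measurableSet_Ioi c2, integral_Ioi_rpow_of_lt (by norm_num) one_pos,
    ← intervalIntegral.integral_of_le zero_le_one]
  have iq : IntervalIntegrable q volume 0 1 :=
    (intervalIntegrable_iff_integrableOn_Ioc_of_le zero_le_one).2 i1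
  have ftc := intervalIntegral.integral_eq_sub_of_hasDerivAt_of_tendsto
    (f := fun v : ℝ => -3 * (v ^ ((-1:ℝ)/3) * (1 - (1 - v) ^ ((7:ℝ)/6))))
    (f' := fun v => q v - 7/2 * (v ^ (-(1:ℝ)/3) * (1 - v) ^ ((1:ℝ)/6)))
    (a := 0) (b := 1) one_pos (fa := 0) (fb := -3) ?_ ?_ ?_ ?_
  · rw [intervalIntegral.integral_sub iq, intervalIntegral.integral_const_mul] at ftc
    · norm_num at ftc ⊢
      linarith
    · convert ib.const_mul (7/2) using 1
      norm_num
  · intro v hv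
    have h1 : HasDerivAt (fun v : ℝ => v ^ ((-1:ℝ)/3)) ((-1:ℝ)/3 * v ^ ((-1:ℝ)/3 - 1)) v :=
      hasDerivAt_rpow_const (Or.inl hv.1.ne')
    have h2 : HasDerivAt (fun v : ℝ => (1 - v) ^ ((7:ℝ)/6))
        (-1 * ((7:ℝ)/6) * (1 - v) ^ ((7:ℝ)/6 - 1)) v :=
      ((hasDerivAt_id v).const_sub 1).rpow_const (Or.inl (by simp; linarith [hv.2]))
    refine ((h1.mul (h2.const_sub 1)).const_mul (-3)).congr_deriv ?_
    rw [hq]; dsimp only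
    rw [max_eq_left (by linarith [hv.2])]
    norm_num
    ring
  · refine iq.sub ?_
    convert ib.const_mul (7/2) using 1
    norm_num
  · have : Tendsto (fun v : ℝ => 7/2 * v ^ ((2:ℝ)/3)) (nhdsWithin 0 (Ioi 0)) (nhds 0) := by
      have : Continuous (fun v : ℝ => 7/2 * v ^ ((2:ℝ)/3)) :=
        continuous_const.mul (continuous_id.rpow_const (by intro; right; norm_num))
      convert (this.tendsto 0).mono_left nhdsWithin_le_nhds using 2
      rw [zero_rpow (by norm_num)]; simp
    refine squeeze_zero_norm' ?_ this
    filter_upwards [Ioc_mem_nhdsGT (zero_lt_one (α := ℝ))] with v hv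
    have hp : 0 < v ^ ((-1:ℝ)/3) := rpow_pos_of_pos hv.1 _
    have e : v ^ ((2:ℝ)/3) = v ^ ((-1:ℝ)/3) * v := by
      nth_rw 3 [← rpow_one v]; rw [← rpow_add hv.1]; norm_num
    rw [norm_mul, Real.norm_of_nonneg (mul_nonneg hp.le (b1 v hv).1), e]
    norm_num
    nlinarith [mul_le_mul_of_nonneg_left (b1 v hv).2 hp.le]
  · have : ContinuousAt (fun v : ℝ => -3 * (v ^ ((-1:ℝ)/3) * (1 - (1 - v) ^ ((7:ℝ)/6)))) 1 := by
      refine continuousAt_const.mul ((continuousAt_rpow_const _ _ (by simp)).mul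
        (continuousAt_const.sub (ContinuousAt.rpow_const (by fun_prop) (by norm_num))))
    convert this.tendsto.mono_left nhdsWithin_le_nhds using 2
    norm_num

open MeasureTheory Set Real in
lemma integral_regularizedBeta_sq :
    IntegrableOn (fun u : ℝ => u ^ ((-5:ℝ)/3) * (1 - (max (1 - u^2) 0) ^ ((7:ℝ)/6))) (Ioi 0) ∧
    ∫ u in Ioi (0:ℝ), u ^ ((-5:ℝ)/3) * (1 - (max (1 - u^2) 0) ^ ((7:ℝ)/6))
      = 7/4 * (Gamma (2/3) * Gamma (7/6) / Gamma (11/6)) := by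
  obtain ⟨hi, hv⟩ := integral_regularizedBeta
  have e : EqOn (fun u : ℝ => ((2:ℝ) * u ^ ((2:ℝ) - 1)) •
      ((u ^ (2:ℝ)) ^ ((-4:ℝ)/3) * (1 - (max (1 - u ^ (2:ℝ)) 0) ^ ((7:ℝ)/6))))
      (fun u => 2 * (u ^ ((-5:ℝ)/3) * (1 - (max (1 - u^2) 0) ^ ((7:ℝ)/6)))) (Ioi 0) := by
    intro u (hu : 0 < u)
    have : u ^ ((-5:ℝ)/3) = u ^ ((2:ℝ) - 1) * (u ^ (2:ℝ)) ^ ((-4:ℝ)/3) := by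
      rw [← rpow_mul hu.le, ← rpow_add hu]; norm_num
    dsimp only
    rw [this, smul_eq_mul, rpow_ofNat]
    ring
  rw [← integrableOn_Ioi_comp_rpow_iff _ (two_ne_zero (α := ℝ)), abs_of_pos two_pos] at hi
  rw [← integral_comp_rpow_Ioi_of_pos two_pos, setIntegral_congr_fun measurableSet_Ioi e,
    integral_const_mul] at hv
  refine ⟨?_, by linarith⟩
  refine IntegrableOn.congr_fun (Integrable.const_mul (hi.congr_fun e measurableSet_Ioi) (1/2))
    (fun u _ => ?_) measurableSet_Ioi
  ring

open Real in
lemma max_sq_mul_rpow {a : ℝ} (ha : 0 < a) (b : ℝ) :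
    (max (a^2 * b) 0) ^ ((7:ℝ)/6) = a ^ ((7:ℝ)/3) * (max b 0) ^ ((7:ℝ)/6) := by
  have : max (a^2 * b) 0 = a^2 * max b 0 := by
    rw [mul_max_of_nonneg _ _ (sq_nonneg a), mul_zero]
  rw [this, mul_rpow (sq_nonneg a) (le_max_right _ _), ← rpow_natCast a 2, ← rpow_mul ha.le]
  norm_num

/-- The prefactor in `besselK_five_thirds_eq`. -/
noncomputable def besselPrefactor : ℝ :=
  √Real.pi / Real.Gamma (13/6) / 2 ^ ((5:ℝ)/3)

open MeasureTheory Set Real in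
lemma besselK_five_thirds_eq {y : ℝ} (hy : 0 < y) :
    besselK (5/3) y = besselPrefactor * y ^ ((-5:ℝ)/3) *
      ∫ s in Ioi (0:ℝ), exp (-s) * (max (s^2 - y^2) 0) ^ ((7:ℝ)/6) := by
  set G : ℝ → ℝ := fun s => exp (-s) * (max (s^2 - y^2) 0) ^ ((7:ℝ)/6) with hG
  have e : EqOn (fun t : ℝ => exp (-y * t) * (t^2 - 1) ^ ((5:ℝ)/3 - 1/2))
      (fun t => y ^ ((-7:ℝ)/3) * G (y * t)) (Ioi 1) := by
    intro t (ht : 1 < t)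
    have h1 : (y * t)^2 - y^2 = y^2 * (t^2 - 1) := by ring
    rw [hG]; dsimp only
    rw [h1, max_sq_mul_rpow hy, max_eq_left (by nlinarith)]
    have h2 : y ^ ((-7:ℝ)/3) * y ^ ((7:ℝ)/3) = 1 := by
      rw [← rpow_add hy]; norm_num
    have h3 : (5:ℝ)/3 - 1/2 = 7/6 := by norm_num
    rw [h3, neg_mul]
    linear_combination (-(exp (-(y * t)) * (t^2 - 1) ^ ((7:ℝ)/6))) * h2
  have hsub : ∫ s in Ioi (0:ℝ), G s = ∫ s in Ioi y, G s := by
    refine setIntegral_eq_of_subset_of_forall_sdiff_eq_zero measurableSet_Ioi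
      (Ioi_subset_Ioi hy.le) ?_
    rintro s ⟨hs0, hs⟩
    have hs0' : 0 < s := hs0
    have hs' : s ≤ y := not_lt.1 hs
    rw [hG]; dsimp only
    rw [max_eq_right (by nlinarith), zero_rpow (by norm_num), mul_zero]
  rw [besselK, setIntegral_congr_fun measurableSet_Ioi e, integral_const_mul,
    integral_comp_mul_left_Ioi _ _ hy, hsub, mul_one, smul_eq_mul, besselPrefactor,
    div_rpow hy.le two_pos.le]
  have h4 : y ^ ((5:ℝ)/3) * (y ^ ((-7:ℝ)/3) * y⁻¹) = y ^ ((-5:ℝ)/3) := by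
    rw [← rpow_neg_one y, ← rpow_add hy, ← rpow_add hy]; norm_num
  have h5 : (5:ℝ)/3 + 1/2 = 13/6 := by norm_num
  rw [← h4, h5]
  ring

/-- The integrand representing the difference between `besselK (5/3)` and its leading term. -/
noncomputable def besselDefect (s y : ℝ) : ℝ :=
  Real.exp (-s) * y ^ ((-5:ℝ)/3) * (s ^ ((7:ℝ)/3) - (max (s^2 - y^2) 0) ^ ((7:ℝ)/6))

lemma measurable_besselDefect : Measurable (Function.uncurry besselDefect) := by
  unfold besselDefect Function.uncurry
  fun_prop

open Real in
lemma max_sq_sub_sq_rpow_le {s : ℝ} (hs : 0 ≤ s) (y : ℝ) :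
    (max (s^2 - y^2) 0) ^ ((7:ℝ)/6) ≤ s ^ ((7:ℝ)/3) := by
  calc (max (s^2 - y^2) 0) ^ ((7:ℝ)/6) ≤ (s^2) ^ ((7:ℝ)/6) := by
        refine rpow_le_rpow (le_max_right _ _) (max_le ?_ ?_) (by norm_num) <;> nlinarith
    _ = s ^ ((7:ℝ)/3) := by
        rw [← rpow_natCast s 2, ← rpow_mul hs]; norm_num

open Real in
lemma besselDefect_nonneg {s y : ℝ} (hs : 0 < s) (hy : 0 < y) : 0 ≤ besselDefect s y :=
  mul_nonneg (by positivity) (sub_nonneg.2 (max_sq_sub_sq_rpow_le hs.le y))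

open MeasureTheory Set Real in
lemma integral_besselDefect {s : ℝ} (hs : 0 < s) :
    IntegrableOn (besselDefect s) (Ioi 0) ∧
    ∫ y in Ioi (0:ℝ), besselDefect s y
      = exp (-s) * s ^ ((5:ℝ)/3) * (7/4 * (Gamma (2/3) * Gamma (7/6) / Gamma (11/6))) := by
  obtain ⟨hi, hv⟩ := integral_regularizedBeta_sq
  have e : EqOn (fun u => exp (-s) * s ^ ((2:ℝ)/3) *
      (u ^ ((-5:ℝ)/3) * (1 - (max (1 - u^2) 0) ^ ((7:ℝ)/6))))
      (fun u => besselDefect s (s * u)) (Ioi 0) := by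
    intro u (hu : 0 < u)
    have h1 : s^2 - (s * u)^2 = s^2 * (1 - u^2) := by ring
    have h2 : s ^ ((2:ℝ)/3) = s ^ ((-5:ℝ)/3) * s ^ ((7:ℝ)/3) := by
      rw [← rpow_add hs]; norm_num
    simp only [besselDefect]
    rw [h1, max_sq_mul_rpow hs, mul_rpow hs.le hu.le, h2]
    ring
  constructor
  · have := IntegrableOn.congr_fun (Integrable.const_mul hi (exp (-s) * s ^ ((2:ℝ)/3))) e
      measurableSet_Ioi
    rwa [integrableOn_Ioi_comp_mul_left_iff _ _ hs, mul_zero] at this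
  · have h3 := integral_comp_mul_left_Ioi (besselDefect s) 0 hs
    rw [← setIntegral_congr_fun measurableSet_Ioi e, integral_const_mul, hv, mul_zero,
      smul_eq_mul, eq_inv_mul_iff_mul_eq₀ hs.ne'] at h3
    have h4 : s ^ ((5:ℝ)/3) = s * s ^ ((2:ℝ)/3) := by
      nth_rw 2 [← rpow_one s]; rw [← rpow_add hs]; norm_num
    rw [← h3, h4]
    ring

open MeasureTheory Set Real in
lemma integrable_besselDefect_prod :
    Integrable (Function.uncurry besselDefect)
      ((volume.restrict (Ioi 0)).prod (volume.restrict (Ioi 0))) := by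
  rw [integrable_prod_iff measurable_besselDefect.aestronglyMeasurable]
  constructor
  · filter_upwards [ae_restrict_mem measurableSet_Ioi] with s hs
    exact (integral_besselDefect hs).1
  · have hg := Real.GammaIntegral_convergent (s := 8/3) (by norm_num)
    refine IntegrableOn.congr_fun (Integrable.mul_const hg
      (7/4 * (Gamma (2/3) * Gamma (7/6) / Gamma (11/6)))) (fun s hs => ?_) measurableSet_Ioi
    have h1 : ∫ y in Ioi (0:ℝ), ‖Function.uncurry besselDefect (s, y)‖
        = ∫ y in Ioi (0:ℝ), besselDefect s y :=
      setIntegral_congr_fun measurableSet_Ioi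
        (fun y hy => Real.norm_of_nonneg (besselDefect_nonneg hs hy))
    rw [h1, (integral_besselDefect hs).2]
    norm_num

open MeasureTheory Set Real in
lemma integral_integral_besselDefect :
    IntegrableOn (fun y => ∫ s in Ioi (0:ℝ), besselDefect s y) (Ioi 0) ∧
    ∫ y in Ioi (0:ℝ), ∫ s in Ioi (0:ℝ), besselDefect s y
      = Gamma (8/3) * (7/4 * (Gamma (2/3) * Gamma (7/6) / Gamma (11/6))) := by
  refine ⟨integrable_besselDefect_prod.integral_prod_right, ?_⟩
  rw [← integral_integral_swap integrable_besselDefect_prod,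
    setIntegral_congr_fun measurableSet_Ioi (fun s hs => (integral_besselDefect hs).2),
    integral_mul_const, Gamma_eq_integral (s := 8/3) (by norm_num)]
  norm_num

open MeasureTheory Set Real in
lemma besselK_eq_sub_defect {y : ℝ} (hy : 0 < y) :
    besselK (5/3) y = besselPrefactor * (Gamma (10/3) * y ^ ((-5:ℝ)/3)
      - ∫ s in Ioi (0:ℝ), besselDefect s y) := by
  have hg := Real.GammaIntegral_convergent (s := 10/3) (by norm_num)
  have hv := Real.Gamma_eq_integral (s := 10/3) (by norm_num)
  have h73 : (10:ℝ)/3 - 1 = 7/3 := by norm_num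
  rw [h73] at hg hv
  have hG : IntegrableOn (fun s => exp (-s) * (max (s^2 - y^2) 0) ^ ((7:ℝ)/6)) (Ioi 0) := by
    refine Integrable.mono' hg (by fun_prop) ?_
    filter_upwards [ae_restrict_mem measurableSet_Ioi] with s (hs : 0 < s)
    rw [Real.norm_of_nonneg (by positivity)]
    exact mul_le_mul_of_nonneg_left (max_sq_sub_sq_rpow_le hs.le y) (exp_pos _).le
  have h1 : ∫ s in Ioi (0:ℝ), besselDefect s y = y ^ ((-5:ℝ)/3) *
      (Gamma (10/3) - ∫ s in Ioi (0:ℝ), exp (-s) * (max (s^2 - y^2) 0) ^ ((7:ℝ)/6)) := by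
    rw [hv, ← integral_sub hg hG, ← integral_const_mul]
    congr 1 with s
    rw [besselDefect]; ring
  rw [besselK_five_thirds_eq hy, h1]
  ring

open MeasureTheory Set Real in
lemma exists_besselDefect_bound :
    ∃ C : ℝ, ∀ y : ℝ, 0 < y →
      |(∫ s in Ioi (0:ℝ), besselDefect s y) - 7/6 * Gamma (4/3) * y ^ ((1:ℝ)/3)|
        ≤ C * y ^ ((5:ℝ)/3) := by
  set ρ : ℝ → ℝ := fun σ => 7/6 * σ ^ ((1:ℝ)/3) - σ ^ ((7:ℝ)/3)
      + (max (σ^2 - 1) 0) ^ ((7:ℝ)/6) with hρ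
  have hi : IntegrableOn ρ (Ioi 0) := integrableOn_besselProfile
  refine ⟨∫ σ in Ioi (0:ℝ), |ρ σ|, fun y hy => ?_⟩
  have hg := Real.GammaIntegral_convergent (s := 4/3) (by norm_num)
  have hv := Real.Gamma_eq_integral (s := 4/3) (by norm_num)
  have h73 : (4:ℝ)/3 - 1 = 1/3 := by norm_num
  rw [h73] at hg hv
  have hd := integral_comp_mul_left_Ioi (fun s => besselDefect s y
      - 7/6 * y ^ ((1:ℝ)/3) * (exp (-s) * s ^ ((1:ℝ)/3))) 0 hy
  have e : ∀ σ ∈ Ioi (0:ℝ), besselDefect (y * σ) y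
      - 7/6 * y ^ ((1:ℝ)/3) * (exp (-(y * σ)) * (y * σ) ^ ((1:ℝ)/3))
      = -(y ^ ((2:ℝ)/3) * (exp (-(y * σ)) * ρ σ)) := by
    intro σ (hσ : 0 < σ)
    have h1 : (y * σ)^2 - y^2 = y^2 * (σ^2 - 1) := by ring
    have h2 : y ^ ((2:ℝ)/3) = y ^ ((-5:ℝ)/3) * y ^ ((7:ℝ)/3) := by
      rw [← rpow_add hy]; norm_num
    have h3 : y ^ ((2:ℝ)/3) = y ^ ((1:ℝ)/3) * y ^ ((1:ℝ)/3) := by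
      rw [← rpow_add hy]; norm_num
    rw [hρ, besselDefect, h1, max_sq_mul_rpow hy, mul_rpow hy.le hσ.le, mul_rpow hy.le hσ.le]
    linear_combination (7/6 * exp (-(y * σ)) * σ ^ ((1:ℝ)/3)) * h3
      + (exp (-(y * σ)) * ((max (σ^2 - 1) 0) ^ ((7:ℝ)/6) - σ ^ ((7:ℝ)/3))) * h2
  have hint : IntegrableOn (fun s => besselDefect s y) (Ioi 0) := by
    have hg := Real.GammaIntegral_convergent (s := 10/3) (by norm_num)
    refine Integrable.mono' (Integrable.mul_const hg (y ^ ((-5:ℝ)/3)))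
      (by unfold besselDefect; fun_prop) ?_
    filter_upwards [ae_restrict_mem measurableSet_Ioi] with s (hs : 0 < s)
    rw [Real.norm_of_nonneg (besselDefect_nonneg hs hy), besselDefect, mul_right_comm]
    have h73 : (10:ℝ)/3 - 1 = 7/3 := by norm_num
    rw [h73]
    gcongr
    rw [sub_le_self_iff]
    positivity
  have hsub : (∫ s in Ioi (0:ℝ), besselDefect s y) - 7/6 * Gamma (4/3) * y ^ ((1:ℝ)/3)
      = ∫ s in Ioi (0:ℝ), (besselDefect s y
      - 7/6 * y ^ ((1:ℝ)/3) * (exp (-s) * s ^ ((1:ℝ)/3))) := by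
    rw [integral_sub hint (Integrable.const_mul hg _), integral_const_mul, hv]
    ring
  rw [setIntegral_congr_fun measurableSet_Ioi e, mul_zero, smul_eq_mul,
    eq_inv_mul_iff_mul_eq₀ hy.ne', integral_neg, integral_const_mul] at hd
  have h4 : y ^ ((5:ℝ)/3) = y * y ^ ((2:ℝ)/3) := by
    nth_rw 2 [← rpow_one y]; rw [← rpow_add hy]; norm_num
  rw [hsub, ← hd, h4, mul_neg, abs_neg, ← mul_assoc, abs_mul, abs_of_pos (by positivity),
    mul_comm]
  refine mul_le_mul_of_nonneg_right ?_ (by positivity)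
  refine norm_integral_le_of_norm_le (f := fun σ => exp (-(y * σ)) * ρ σ) hi.abs ?_
  filter_upwards [ae_restrict_mem measurableSet_Ioi] with σ (hσ : 0 < σ)
  rw [norm_mul, Real.norm_of_nonneg (exp_pos _).le, Real.norm_eq_abs]
  exact mul_le_of_le_one_left (abs_nonneg _) (exp_le_one_iff.2 (by nlinarith))

open Real in
lemma besselPrefactor_mul_leading :
    besselPrefactor * (3/2 * Gamma (10/3)) = 2 ^ ((2:ℝ)/3) * Gamma (2/3) := by
  have h1 := Real.Gamma_mul_Gamma_add_half (5/3)
  have h2 := Real.Gamma_add_one (s := 2/3) (by norm_num)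
  norm_num at h1 h2
  have hp : 0 < Gamma (13/6) := Gamma_pos_of_pos (by norm_num)
  have h3 : (2:ℝ) ^ ((5:ℝ)/3) * 2 ^ ((2:ℝ)/3) * 2 ^ ((-7:ℝ)/3) = 1 := by
    rw [← rpow_add two_pos, ← rpow_add two_pos]; norm_num
  rw [h2] at h1
  rw [besselPrefactor, div_div, div_mul_eq_mul_div, div_eq_iff (by positivity)]
  norm_num at h3 ⊢
  linear_combination (-3/2 * 2 ^ ((5:ℝ)/3) * 2 ^ ((2:ℝ)/3)) * h1
    - (3/2 * √π * Gamma (10/3)) * h3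

open Real in
lemma besselPrefactor_mul_second :
    besselPrefactor * (3/4 * (7/6 * Gamma (4/3))) = 3 * Gamma (2/3) / 4 ^ ((5:ℝ)/3) := by
  have h1 := Real.Gamma_mul_Gamma_add_half (2/3)
  have h2 := Real.Gamma_add_one (s := 7/6) (by norm_num)
  norm_num at h1 h2
  have hp : 0 < Gamma (7/6) := Gamma_pos_of_pos (by norm_num)
  have h3 : (4:ℝ) ^ ((5:ℝ)/3) = 4 * 2 ^ ((5:ℝ)/3) * 2 ^ ((-1:ℝ)/3) := by
    rw [show (4:ℝ) = 2 ^ (2:ℝ) by norm_num, ← rpow_mul two_pos.le, ← rpow_add two_pos,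
      ← rpow_add two_pos]
    norm_num
  rw [besselPrefactor, h2, div_div, div_mul_eq_mul_div, div_eq_div_iff (by positivity)
    (by positivity), h3]
  norm_num at h1 ⊢
  linear_combination (-7/2 * 2 ^ ((5:ℝ)/3)) * h1

open Real in
lemma besselPrefactor_mul_constant :
    besselPrefactor * (Gamma (8/3) * (7/4 * (Gamma (2/3) * Gamma (7/6) / Gamma (11/6))))
      = π / √3 := by
  have h1 := Real.Gamma_mul_Gamma_add_half (4/3)
  have h2 := Real.Gamma_add_one (s := 7/6) (by norm_num)
  have h3 := Real.Gamma_add_one (s := 1/3) (by norm_num)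
  have h4 := Real.Gamma_mul_Gamma_one_sub (1/3)
  rw [show π * (1/3) = π / 3 by ring, sin_pi_div_three] at h4
  norm_num at h1 h2 h3 h4
  have hp : 0 < Gamma (7/6) := Gamma_pos_of_pos (by norm_num)
  have hq : 0 < Gamma (11/6) := Gamma_pos_of_pos (by norm_num)
  have h5 : (2:ℝ) ^ ((5:ℝ)/3) * 2 ^ ((-5:ℝ)/3) = 1 := by
    rw [← rpow_add two_pos]; norm_num
  norm_num at h5
  have h6 : π / √3 = 1/2 * (Gamma (1/3) * Gamma (2/3)) := by rw [h4]; ring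
  rw [h3] at h1
  rw [h6, besselPrefactor, h2]
  field_simp
  norm_num at h1 ⊢
  linear_combination (-12 * 2 ^ ((5:ℝ)/3)) * h1 - (12 * Gamma (8/3) * √π) * h5

open MeasureTheory Set Real in
lemma exists_synchrotronF_bound :
    ∃ C : ℝ, ∀ x : ℝ, 0 < x →
      |synchrotronF x - 2 ^ ((2:ℝ)/3) * Gamma (2/3) * x ^ ((1:ℝ)/3) + (π / √3) * x
        - (3 * Gamma (2/3) / 4 ^ ((5:ℝ)/3)) * x ^ ((7:ℝ)/3)| ≤ C * x ^ ((11:ℝ)/3) := by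
  obtain ⟨C, hC⟩ := exists_besselDefect_bound
  obtain ⟨hDi, hDv⟩ := integral_integral_besselDefect
  set D : ℝ → ℝ := fun y => ∫ s in Ioi (0:ℝ), besselDefect s y with hD
  have hc : 0 ≤ besselPrefactor := by
    have : 0 < Gamma (13/6) := Gamma_pos_of_pos (by norm_num)
    unfold besselPrefactor
    positivity
  refine ⟨besselPrefactor * (3/8 * C), fun x hx => ?_⟩
  have hDx : IntegrableOn D (Ioi x) := hDi.mono_set (Ioi_subset_Ioi hx.le)
  have hD0 : IntegrableOn D (Ioc 0 x) := hDi.mono_set Ioc_subset_Ioi_self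
  have hsplit : ∫ y in Ioi (0:ℝ), D y = (∫ y in (0:ℝ)..x, D y) + ∫ y in Ioi x, D y := by
    rw [intervalIntegral.integral_of_le hx.le, ← Ioc_union_Ioi_eq_Ioi hx.le,
      setIntegral_union (Ioc_disjoint_Ioi le_rfl) measurableSet_Ioi hD0 hDx]
  have hK : ∫ y in Ioi x, besselK (5/3) y = besselPrefactor *
      (Gamma (10/3) * (3/2 * x ^ ((-2:ℝ)/3)) - ∫ y in Ioi x, D y) := by
    have hp := integral_Ioi_rpow_of_lt (a := -5/3) (by norm_num) hx
    have hpi := integrableOn_Ioi_rpow_of_lt (a := -5/3) (by norm_num) hx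
    rw [setIntegral_congr_fun measurableSet_Ioi
      (fun y (hy : x < y) => besselK_eq_sub_defect (hx.trans hy)), integral_const_mul,
      integral_sub (Integrable.const_mul hpi _) hDx, integral_const_mul, hp]
    have h23 : (-5:ℝ)/3 + 1 = -2/3 := by norm_num
    rw [h23]
    ring
  have hDI : IntervalIntegrable D volume 0 x :=
    (intervalIntegrable_iff_integrableOn_Ioc_of_le hx.le).2 hD0
  have hE : |(∫ y in (0:ℝ)..x, D y) - 7/6 * Gamma (4/3) * (3/4 * x ^ ((4:ℝ)/3))|
      ≤ 3/8 * C * x ^ ((8:ℝ)/3) := by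
    have i1 : IntervalIntegrable (fun y : ℝ => y ^ ((1:ℝ)/3)) volume 0 x :=
      intervalIntegral.intervalIntegrable_rpow' (by norm_num)
    have i2 : IntervalIntegrable (fun y : ℝ => y ^ ((5:ℝ)/3)) volume 0 x :=
      intervalIntegral.intervalIntegrable_rpow' (by norm_num)
    have v1 : ∫ y in (0:ℝ)..x, y ^ ((1:ℝ)/3) = 3/4 * x ^ ((4:ℝ)/3) := by
      rw [integral_rpow (Or.inl (by norm_num)), zero_rpow (by norm_num),
        show (1:ℝ)/3 + 1 = 4/3 by norm_num]
      ring
    have v2 : ∫ y in (0:ℝ)..x, y ^ ((5:ℝ)/3) = 3/8 * x ^ ((8:ℝ)/3) := by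
      rw [integral_rpow (Or.inl (by norm_num)), zero_rpow (by norm_num),
        show (5:ℝ)/3 + 1 = 8/3 by norm_num]
      ring
    rw [← v1, ← intervalIntegral.integral_const_mul,
      ← intervalIntegral.integral_sub hDI (i1.const_mul _)]
    have := intervalIntegral.norm_integral_le_of_norm_le hx.le
      (f := fun y => D y - 7/6 * Gamma (4/3) * y ^ ((1:ℝ)/3))
      (g := fun y => C * y ^ ((5:ℝ)/3)) (μ := volume)
      (Eventually.of_forall fun y hy => hC y hy.1) (i2.const_mul C)
    rw [intervalIntegral.integral_const_mul, v2] at this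
    refine this.trans_eq ?_
    ring
  have x1 : x ^ ((1:ℝ)/3) = x * x ^ ((-2:ℝ)/3) := by
    nth_rw 2 [← rpow_one x]; rw [← rpow_add hx]; norm_num
  have x2 : x ^ ((7:ℝ)/3) = x * x ^ ((4:ℝ)/3) := by
    nth_rw 2 [← rpow_one x]; rw [← rpow_add hx]; norm_num
  have x3 : x ^ ((11:ℝ)/3) = x * x ^ ((8:ℝ)/3) := by
    nth_rw 2 [← rpow_one x]; rw [← rpow_add hx]; norm_num
  have hF : synchrotronF x - 2 ^ ((2:ℝ)/3) * Gamma (2/3) * x ^ ((1:ℝ)/3) + (π / √3) * x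
        - (3 * Gamma (2/3) / 4 ^ ((5:ℝ)/3)) * x ^ ((7:ℝ)/3)
      = besselPrefactor * x *
        ((∫ y in (0:ℝ)..x, D y) - 7/6 * Gamma (4/3) * (3/4 * x ^ ((4:ℝ)/3))) := by
    rw [← besselPrefactor_mul_leading, ← besselPrefactor_mul_second,
      ← besselPrefactor_mul_constant, ← hDv, hsplit, synchrotronF, hK, x1, x2]
    ring
  rw [hF, abs_mul, abs_of_nonneg (by positivity), x3]
  calc _ ≤ besselPrefactor * x * (3/8 * C * x ^ ((8:ℝ)/3)) :=
        mul_le_mul_of_nonneg_left hE (by positivity)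
    _ = _ := by ring

/-- As x → 0⁺,
F(x) − 2^{2/3} Γ(2/3) x^{1/3} + (π/√3) x − (3 Γ(2/3)/4^{5/3}) x^{7/3} = O(x^{11/3}). -/
theorem synchrotronF_small_x_expansion :
    (fun x : ℝ => synchrotronF x - 2 ^ ((2:ℝ)/3) * Real.Gamma (2/3) * x ^ ((1:ℝ)/3)
        + (Real.pi / Real.sqrt 3) * x
        - (3 * Real.Gamma (2/3) / 4 ^ ((5:ℝ)/3)) * x ^ ((7:ℝ)/3))
      =O[nhdsWithin 0 (Set.Ioi 0)] (fun x : ℝ => x ^ ((11:ℝ)/3)) := by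
  obtain ⟨C, hC⟩ := exists_synchrotronF_bound
  refine IsBigO.of_bound C ?_
  filter_upwards [self_mem_nhdsWithin] with x (hx : 0 < x)
  rw [Real.norm_eq_abs, Real.norm_of_nonneg (Real.rpow_nonneg hx.le _)]
  exact hC x hx
end

section
/- As x → 0 from the right, F(x) / x^{1/3} tends to 2^{2/3} Γ(2/3). -/
open Filter

open MeasureTheory Set

/-- The integral `∫₀^∞ e^{-s} (s² - x²)₊^{ν - 1/2} ds`, which is `x ^ ν * besselK ν x` up to
a constant factor. -/
noncomputable def scaledBesselIntegral (ν x : ℝ) : ℝ :=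
  ∫ s in Ioi (0 : ℝ), Real.exp (-s) * max (s ^ 2 - x ^ 2) 0 ^ (ν - 1 / 2)

lemma norm_exp_neg_mul_max_rpow_le {ν : ℝ} (hν : 1 / 2 < ν) (x : ℝ) {s : ℝ} (hs : 0 < s) :
    ‖Real.exp (-s) * max (s ^ 2 - x ^ 2) 0 ^ (ν - 1 / 2)‖ ≤
      Real.exp (-s) * s ^ (2 * ν - 1) := by
  rw [Real.norm_of_nonneg (by positivity)]
  have h : s ^ (2 * ν - 1) = (s ^ 2) ^ (ν - 1 / 2) := by
    rw [← Real.rpow_natCast, ← Real.rpow_mul hs.le]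
    congr 1
    push_cast
    ring
  rw [h]
  have hmax : max (s ^ 2 - x ^ 2) 0 ≤ s ^ 2 := max_le (by nlinarith [sq_nonneg x]) (sq_nonneg s)
  exact mul_le_mul_of_nonneg_left
    (Real.rpow_le_rpow (le_max_right _ _) hmax (by linarith)) (Real.exp_pos _).le

lemma continuous_scaledBesselIntegral {ν : ℝ} (hν : 1 / 2 < ν) :
    Continuous (scaledBesselIntegral ν) := by
  have hν' : 0 ≤ ν - 1 / 2 := by linarith
  refine continuous_of_dominated (bound := fun s => Real.exp (-s) * s ^ (2 * ν - 1)) ?_ ?_ ?_ ?_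
  · intro x
    refine Continuous.aestronglyMeasurable ?_
    exact (by fun_prop : Continuous fun s : ℝ => Real.exp (-s)).mul
      ((by fun_prop : Continuous fun s : ℝ => max (s ^ 2 - x ^ 2) 0).rpow_const
        fun _ => Or.inr hν')
  · intro x
    filter_upwards [ae_restrict_mem measurableSet_Ioi] with s hs
    exact norm_exp_neg_mul_max_rpow_le hν x hs
  · exact Real.GammaIntegral_convergent (by linarith)
  · refine Eventually.of_forall fun s => continuous_const.mul ?_
    exact (by fun_prop : Continuous fun x : ℝ => max (s ^ 2 - x ^ 2) 0).rpow_const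
        fun _ => Or.inr hν'

lemma norm_scaledBesselIntegral_le {ν : ℝ} (hν : 1 / 2 < ν) (x : ℝ) :
    ‖scaledBesselIntegral ν x‖ ≤ Real.Gamma (2 * ν) := by
  rw [Real.Gamma_eq_integral (by linarith)]
  refine norm_integral_le_of_norm_le (Real.GammaIntegral_convergent (by linarith)) ?_
  filter_upwards [ae_restrict_mem measurableSet_Ioi] with s hs
  exact norm_exp_neg_mul_max_rpow_le hν x hs

lemma scaledBesselIntegral_zero {ν : ℝ} (hν : 1 / 2 < ν) :
    scaledBesselIntegral ν 0 = Real.Gamma (2 * ν) := by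
  rw [Real.Gamma_eq_integral (by linarith)]
  refine setIntegral_congr_fun measurableSet_Ioi fun s (hs : 0 < s) => ?_
  have h : max (s ^ 2 - 0 ^ 2) 0 = s ^ (2 : ℝ) := by
    rw [max_eq_left (by nlinarith)]
    norm_num
  simp only [h]
  rw [← Real.rpow_mul hs.le]
  congr 2
  ring

lemma scaledBesselIntegral_eq {ν x : ℝ} (hν : 1 / 2 < ν) (hx : 0 < x) :
    scaledBesselIntegral ν x =
      x ^ (2 * ν) * ∫ t in Ioi (1 : ℝ), Real.exp (-x * t) * (t ^ 2 - 1) ^ (ν - 1 / 2) := by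
  have hsub : scaledBesselIntegral ν x =
      ∫ s in Ioi x, Real.exp (-s) * max (s ^ 2 - x ^ 2) 0 ^ (ν - 1 / 2) := by
    refine setIntegral_eq_of_subset_of_forall_sdiff_eq_zero measurableSet_Ioi
      (Ioi_subset_Ioi hx.le) fun s ⟨hs, hsx⟩ => ?_
    simp only [mem_Ioi, not_lt] at hs hsx
    rw [max_eq_right (by nlinarith), Real.zero_rpow (by linarith), mul_zero]
  have hcv := integral_comp_mul_left_Ioi
    (fun s => Real.exp (-s) * max (s ^ 2 - x ^ 2) 0 ^ (ν - 1 / 2)) 1 hx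
  rw [mul_one, ← hsub, smul_eq_mul, eq_inv_mul_iff_mul_eq₀ hx.ne'] at hcv
  rw [← hcv, show 2 * ν = 1 + (2 * ν - 1) by ring, Real.rpow_add hx, Real.rpow_one, mul_assoc,
    ← integral_const_mul (x ^ (2 * ν - 1))]
  congr 1
  refine setIntegral_congr_fun measurableSet_Ioi fun t (ht : 1 < t) => ?_
  have h1 : 0 ≤ t ^ 2 - 1 := by nlinarith
  have h2 : max ((x * t) ^ 2 - x ^ 2) 0 = x ^ (2 : ℝ) * (t ^ 2 - 1) := by
    rw [Real.rpow_two, max_eq_left (by nlinarith [mul_nonneg (sq_nonneg x) h1])]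
    ring
  simp only [h2]
  rw [Real.mul_rpow (by positivity) h1, ← Real.rpow_mul hx.le]
  ring_nf

lemma besselK_eq {ν x : ℝ} (hν : 1 / 2 < ν) (hx : 0 < x) :
    besselK ν x = Real.sqrt Real.pi / Real.Gamma (ν + 1 / 2) * 2 ^ (-ν) *
      (x ^ (-ν) * scaledBesselIntegral ν x) := by
  rw [besselK, scaledBesselIntegral_eq hν hx, Real.div_rpow hx.le zero_le_two,
    Real.rpow_neg zero_le_two, show 2 * ν = ν + ν by ring, Real.rpow_add hx, Real.rpow_neg hx.le]
  have := (Real.rpow_pos_of_pos hx ν).ne'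
  field_simp

lemma rpow_mul_integral_besselK {ν x : ℝ} (hν : 1 / 2 < ν) (hx : 0 < x) :
    x ^ (ν - 1) * ∫ t in Ioi x, besselK ν t =
      Real.sqrt Real.pi / Real.Gamma (ν + 1 / 2) * 2 ^ (-ν) *
        ∫ u in Ioi (1 : ℝ), u ^ (-ν) * scaledBesselIntegral ν (x * u) := by
  have hcv := integral_comp_mul_left_Ioi (besselK ν) 1 hx
  rw [mul_one, smul_eq_mul, eq_inv_mul_iff_mul_eq₀ hx.ne'] at hcv
  rw [← hcv, ← mul_assoc, ← integral_const_mul, ← integral_const_mul]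
  refine setIntegral_congr_fun measurableSet_Ioi fun u (hu : 1 < u) => ?_
  have hu0 : 0 < u := by linarith
  simp only [besselK_eq hν (mul_pos hx hu0)]
  rw [Real.mul_rpow hx.le hu0.le, Real.rpow_sub_one hx.ne', Real.rpow_neg hx.le]
  have := (Real.rpow_pos_of_pos hx ν).ne'
  field_simp

lemma tendsto_integral_rpow_mul_scaledBesselIntegral {ν : ℝ} (hν : 1 < ν) :
    Tendsto (fun x => ∫ u in Ioi (1 : ℝ), u ^ (-ν) * scaledBesselIntegral ν (x * u))
      (nhds 0) (nhds (Real.Gamma (2 * ν) / (ν - 1))) := by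
  have hν' : 1 / 2 < ν := by linarith
  have hc := continuous_scaledBesselIntegral hν'
  have hlim : Real.Gamma (2 * ν) / (ν - 1) =
      ∫ u in Ioi (1 : ℝ), u ^ (-ν) * scaledBesselIntegral ν 0 := by
    rw [integral_mul_const, integral_Ioi_rpow_of_lt (by linarith) one_pos,
      scaledBesselIntegral_zero hν', Real.one_rpow, show -ν + 1 = -(ν - 1) by ring, neg_div_neg_eq]
    ring
  rw [hlim]
  refine tendsto_integral_filter_of_dominated_convergence
    (fun u => u ^ (-ν) * Real.Gamma (2 * ν)) ?_ ?_ ?_ ?_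
  · refine Eventually.of_forall fun x => Measurable.aestronglyMeasurable ?_
    have := (hc.comp (continuous_const_mul x)).measurable
    exact (measurable_id.pow_const _).mul this
  · refine Eventually.of_forall fun x => ?_
    filter_upwards [ae_restrict_mem measurableSet_Ioi] with u (hu : 1 < u)
    have hu0 : 0 ≤ u ^ (-ν) := Real.rpow_nonneg (by linarith) _
    rw [norm_mul, Real.norm_of_nonneg hu0]
    exact mul_le_mul_of_nonneg_left (norm_scaledBesselIntegral_le hν' _) hu0
  · exact (integrableOn_Ioi_rpow_of_lt (by linarith) one_pos).mul_const _
  · refine Eventually.of_forall fun u => Tendsto.const_mul _ ?_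
    exact (hc.comp (continuous_mul_const u)).tendsto' 0 _ (by simp)

lemma sqrt_pi_div_Gamma_mul_Gamma {ν : ℝ} (hν : 0 < ν) :
    Real.sqrt Real.pi / Real.Gamma (ν + 1 / 2) * 2 ^ (-ν) * Real.Gamma (2 * ν) =
      2 ^ (ν - 1) * Real.Gamma ν := by
  have hG : Real.Gamma (ν + 1 / 2) ≠ 0 := (Real.Gamma_pos_of_pos (by linarith)).ne'
  have hdup := Real.Gamma_mul_Gamma_add_half ν
  have hpow : (2 : ℝ) ^ (-ν) = 2 ^ (ν - 1) * 2 ^ (1 - 2 * ν) := by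
    rw [← Real.rpow_add two_pos]
    congr 1
    ring
  rw [hpow, div_mul_eq_mul_div, div_mul_eq_mul_div, div_eq_iff hG]
  linear_combination -(2 : ℝ) ^ (ν - 1) * hdup

lemma tendsto_rpow_mul_integral_besselK {ν : ℝ} (hν : 1 < ν) :
    Tendsto (fun x => x ^ (ν - 1) * ∫ t in Ioi x, besselK ν t)
      (nhdsWithin 0 (Ioi 0)) (nhds (2 ^ (ν - 1) * Real.Gamma (ν - 1))) := by
  have hlim : 2 ^ (ν - 1) * Real.Gamma (ν - 1) =
      Real.sqrt Real.pi / Real.Gamma (ν + 1 / 2) * 2 ^ (-ν) *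
        (Real.Gamma (2 * ν) / (ν - 1)) := by
    have h1 : ν - 1 ≠ 0 := by linarith
    have hrec := Real.Gamma_add_one h1
    rw [sub_add_cancel] at hrec
    rw [← mul_div_assoc, sqrt_pi_div_Gamma_mul_Gamma (by linarith), hrec]
    field_simp
  rw [hlim]
  refine (((tendsto_integral_rpow_mul_scaledBesselIntegral hν).mono_left
    nhdsWithin_le_nhds).const_mul _).congr' ?_
  filter_upwards [self_mem_nhdsWithin] with x hx
  exact (rpow_mul_integral_besselK (by linarith) hx).symm

/-- As x → 0⁺, F(x)/x^{1/3} tends to 2^{2/3} Γ(2/3). -/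
theorem synchrotronF_leading_small_x :
    Tendsto (fun x : ℝ => synchrotronF x / x ^ ((1:ℝ)/3))
      (nhdsWithin 0 (Set.Ioi 0)) (nhds (2 ^ ((2:ℝ)/3) * Real.Gamma (2/3))) := by
  have h := tendsto_rpow_mul_integral_besselK (ν := 5 / 3) (by norm_num)
  rw [show (5 / 3 - 1 : ℝ) = 2 / 3 by norm_num] at h
  refine h.congr' ?_
  filter_upwards [self_mem_nhdsWithin] with x (hx : 0 < x)
  rw [synchrotronF, show (2 / 3 : ℝ) = 1 - 1 / 3 by norm_num, Real.rpow_sub hx, Real.rpow_one]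
  ring
end

section
/- As x → ∞, the synchrotron function satisfies F(x) − √(πx/2) e^{−x} [ 1 + (55/72)(1/x) − (10151/10368)(1/x²) ] = O( e^{−x} x^{−5/2} ). -/
open Filter Asymptotics

open MeasureTheory

lemma abs_one_add_rpow_sub_taylor_le {v : ℝ} (hv : 0 ≤ v) :
    |(1 + v) ^ (7/6 : ℝ) - (1 + 7/6 * v + 7/72 * v ^ 2)| ≤ v ^ 3 := by
  obtain ⟨s, hs, hw⟩ : ∃ s : ℝ, 0 ≤ s ∧ (1 + s) = (1 + v) ^ (1/6 : ℝ) :=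
    ⟨(1 + v) ^ (1/6 : ℝ) - 1, by
      linarith [Real.one_le_rpow (show 1 ≤ 1 + v by linarith)
        (show (0:ℝ) ≤ 1/6 by norm_num)], by ring⟩
  have h6 : (1 + s) ^ 6 = 1 + v := by
    rw [hw, ← Real.rpow_natCast, ← Real.rpow_mul (by positivity)]; norm_num
  have h7 : (1 + v) ^ (7/6 : ℝ) = (1 + s) ^ 7 := by
    rw [hw, ← Real.rpow_natCast, ← Real.rpow_mul (by positivity)]; norm_num
  obtain rfl : v = (1 + s) ^ 6 - 1 := by linarith
  rw [h7, abs_le]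
  constructor
  · rw [← sub_nonneg]; ring_nf; positivity
  · rw [← sub_nonneg]; ring_nf; positivity

lemma integrableOn_rpow_mul_exp_neg_mul_Ioi {s x : ℝ} (hs : -1 < s) (hx : 0 < x) :
    IntegrableOn (fun u : ℝ => u ^ s * Real.exp (-(x * u))) (Set.Ioi 0) := by
  simpa using integrableOn_rpow_mul_exp_neg_mul_rpow hs one_pos hx

lemma integral_exp_mul_sq_sub_one_rpow (x : ℝ) :
    ∫ t in Set.Ioi (1:ℝ), Real.exp (-x * t) * (t^2 - 1) ^ (7/6 : ℝ) =
      Real.exp (-x) * 2 ^ (7/6 : ℝ) *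
        ∫ u in Set.Ioi (0:ℝ), u ^ (7/6 : ℝ) * Real.exp (-(x * u)) * (1 + u/2) ^ (7/6 : ℝ) := by
  have h := (measurePreserving_add_right volume (1:ℝ)).setIntegral_preimage_emb
    (measurableEmbedding_addRight 1)
    (fun t => Real.exp (-x * t) * (t^2 - 1) ^ (7/6 : ℝ)) (Set.Ioi 1)
  rw [← h, ← integral_const_mul]
  simp only [Set.preimage_add_const_Ioi, sub_self]
  refine setIntegral_congr_fun measurableSet_Ioi fun u hu => ?_
  have hu : 0 < u := hu
  have h1 : (u + 1) ^ 2 - 1 = 2 * u * (1 + u/2) := by ring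
  have h2 : Real.exp (-x * (u + 1)) = Real.exp (-x) * Real.exp (-(x * u)) := by
    rw [← Real.exp_add]; ring_nf
  simp only [h1, h2]
  rw [Real.mul_rpow (by positivity) (by positivity), Real.mul_rpow (by positivity) hu.le]
  ring

lemma abs_laplace_integral_sub_le {x : ℝ} (hx : 0 < x) :
    |(∫ u in Set.Ioi (0:ℝ), u ^ (7/6 : ℝ) * Real.exp (-(x * u)) * (1 + u/2) ^ (7/6 : ℝ)) -
      Real.Gamma (13/6) * x ^ (-(13:ℝ)/6) * (1 + 91/72 * (1/x) + 1729/10368 * (1/x^2))| ≤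
      Real.Gamma (31/6) / 8 * x ^ (-(31:ℝ)/6) := by
  have hI : ∀ s : ℝ, 0 < s → ∫ u in Set.Ioi (0:ℝ), u ^ (s - 1) * Real.exp (-(x * u)) =
      Real.Gamma s * x ^ (-s) := fun s hs => by
    rw [Real.integral_rpow_mul_exp_neg_mul_Ioi hs hx, one_div, Real.inv_rpow hx.le,
      Real.rpow_neg hx.le, mul_comm]
  have i1 := integrableOn_rpow_mul_exp_neg_mul_Ioi (s := 7/6) (by norm_num) hx
  have i2 := (integrableOn_rpow_mul_exp_neg_mul_Ioi (s := 13/6) (by norm_num) hx).const_mul (7/12)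
  have i3 := (integrableOn_rpow_mul_exp_neg_mul_Ioi (s := 19/6) (by norm_num) hx).const_mul (7/288)
  have i4 := (integrableOn_rpow_mul_exp_neg_mul_Ioi (s := 25/6) (by norm_num) hx).const_mul (1/8)
  have e1 := hI (13/6) (by norm_num)
  have e2 := hI (19/6) (by norm_num)
  have e3 := hI (25/6) (by norm_num)
  have e4 := hI (31/6) (by norm_num)
  norm_num at e1 e2 e3 e4
  have g2 : Real.Gamma (19/6) = 13/6 * Real.Gamma (13/6) := by
    rw [← Real.Gamma_add_one (by norm_num)]; norm_num
  have g3 : Real.Gamma (25/6) = 19/6 * (13/6 * Real.Gamma (13/6)) := by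
    rw [← g2, ← Real.Gamma_add_one (by norm_num)]; norm_num
  have p2 : x ^ (-(19/6 : ℝ)) = x ^ (-(13:ℝ)/6) * (1/x) := by
    rw [one_div, ← Real.rpow_neg_one, ← Real.rpow_add hx]; norm_num
  have p3 : x ^ (-(25/6 : ℝ)) = x ^ (-(13:ℝ)/6) * (1/x^2) := by
    rw [one_div, ← Real.rpow_natCast, ← Real.rpow_neg hx.le, ← Real.rpow_add hx]; norm_num
  set P : ℝ → ℝ := fun u => u ^ (7/6 : ℝ) * Real.exp (-(x * u)) +
    7/12 * (u ^ (13/6 : ℝ) * Real.exp (-(x * u))) +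
    7/288 * (u ^ (19/6 : ℝ) * Real.exp (-(x * u))) with hP
  have iP : IntegrableOn P (Set.Ioi 0) := (i1.add i2).add i3
  have eP : ∫ u in Set.Ioi (0:ℝ), P u =
      Real.Gamma (13/6) * x ^ (-(13:ℝ)/6) * (1 + 91/72 * (1/x) + 1729/10368 * (1/x^2)) := by
    have i12 := i1.add i2
    refine (integral_add i12 i3).trans ?_
    simp only [Pi.add_apply]
    rw [integral_add i1 i2, integral_const_mul, integral_const_mul,
      e1, e2, e3, g2, g3, p2, p3, neg_div]
    ring
  set R : ℝ → ℝ := fun u =>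
    u ^ (7/6 : ℝ) * Real.exp (-(x * u)) * (1 + u/2) ^ (7/6 : ℝ) - P u with hR
  have hb : ∀ u ∈ Set.Ioi (0:ℝ), ‖R u‖ ≤ 1/8 * (u ^ (25/6 : ℝ) * Real.exp (-(x * u))) := by
    intro u hu
    have hu : 0 < u := hu
    have q1 : u ^ (13/6 : ℝ) = u ^ (7/6 : ℝ) * u := by
      rw [← Real.rpow_add_one hu.ne']; norm_num
    have q2 : u ^ (19/6 : ℝ) = u ^ (7/6 : ℝ) * u ^ 2 := by
      rw [← Real.rpow_add_natCast hu.ne']; norm_num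
    have q3 : u ^ (25/6 : ℝ) = u ^ (7/6 : ℝ) * u ^ 3 := by
      rw [← Real.rpow_add_natCast hu.ne']; norm_num
    have : R u = u ^ (7/6 : ℝ) * Real.exp (-(x * u)) *
        ((1 + u/2) ^ (7/6 : ℝ) - (1 + 7/6 * (u/2) + 7/72 * (u/2) ^ 2)) := by
      simp only [hR, hP, q1, q2]; ring
    rw [this, Real.norm_eq_abs, abs_mul, abs_of_nonneg (by positivity), q3]
    calc _ ≤ u ^ (7/6 : ℝ) * Real.exp (-(x * u)) * (u/2) ^ 3 := by
          gcongr; exact abs_one_add_rpow_sub_taylor_le (by positivity)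
      _ = _ := by ring
  have hb' := (ae_restrict_iff' measurableSet_Ioi (μ := volume)).2 (Eventually.of_forall hb)
  have iR : IntegrableOn R (Set.Ioi 0) := by
    refine Integrable.mono' i4 (Measurable.aestronglyMeasurable ?_) hb'
    simp only [hR, hP]
    fun_prop
  have key : (∫ u in Set.Ioi (0:ℝ), u ^ (7/6 : ℝ) * Real.exp (-(x * u)) * (1 + u/2) ^ (7/6 : ℝ)) =
      (∫ u in Set.Ioi (0:ℝ), P u) + ∫ u in Set.Ioi (0:ℝ), R u := by
    rw [← integral_add iP iR]; simp only [hR, add_sub_cancel]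
  rw [key, eP, add_sub_cancel_left]
  refine (norm_integral_le_of_norm_le i4 hb').trans (le_of_eq ?_)
  rw [integral_const_mul, e4, neg_div]
  ring

lemma exists_abs_besselK_sub_le : ∃ C : ℝ, 0 ≤ C ∧ ∀ x : ℝ, 0 < x →
    |besselK (5/3) x - Real.sqrt (Real.pi / 2) * Real.exp (-x) * x ^ (-(1:ℝ)/2) *
      (1 + 91/72 * (1/x) + 1729/10368 * (1/x^2))| ≤ C * (Real.exp (-x) * x ^ (-(7:ℝ)/2)) := by
  have hΓ : 0 < Real.Gamma (13/6) := Real.Gamma_pos_of_pos (by norm_num)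
  have hΓ' : 0 < Real.Gamma (31/6) := Real.Gamma_pos_of_pos (by norm_num)
  refine ⟨Real.sqrt (Real.pi / 2) / Real.Gamma (13/6) * (Real.Gamma (31/6) / 8),
    by positivity, fun x hx => ?_⟩
  have hc : Real.sqrt Real.pi * (x/2) ^ (5/3 : ℝ) * 2 ^ (7/6 : ℝ) =
      Real.sqrt (Real.pi / 2) * x ^ (5/3 : ℝ) := by
    have : (2:ℝ) ^ (5/3 : ℝ) = 2 ^ (7/6 : ℝ) * Real.sqrt 2 := by
      rw [Real.sqrt_eq_rpow, ← Real.rpow_add two_pos]; norm_num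
    rw [Real.div_rpow hx.le two_pos.le, Real.sqrt_div Real.pi_pos.le, this]
    field_simp
  have hK : besselK (5/3) x = Real.sqrt (Real.pi / 2) / Real.Gamma (13/6) * Real.exp (-x) *
      x ^ (5/3 : ℝ) * ∫ u in Set.Ioi (0:ℝ),
        u ^ (7/6 : ℝ) * Real.exp (-(x * u)) * (1 + u/2) ^ (7/6 : ℝ) := by
    rw [besselK, show (5/3 - 1/2 : ℝ) = 7/6 by norm_num, show (5/3 + 1/2 : ℝ) = 13/6 by norm_num,
      integral_exp_mul_sq_sub_one_rpow]
    linear_combination (Real.exp (-x) / Real.Gamma (13/6) * ∫ u in Set.Ioi (0:ℝ),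
        u ^ (7/6 : ℝ) * Real.exp (-(x * u)) * (1 + u/2) ^ (7/6 : ℝ)) * hc
  have p1 : x ^ (-(1:ℝ)/2) = x ^ (5/3 : ℝ) * x ^ (-(13:ℝ)/6) := by
    rw [← Real.rpow_add hx]; norm_num
  have p2 : x ^ (-(7:ℝ)/2) = x ^ (5/3 : ℝ) * x ^ (-(31:ℝ)/6) := by
    rw [← Real.rpow_add hx]; norm_num
  have hM : 0 ≤ Real.sqrt (Real.pi / 2) / Real.Gamma (13/6) * Real.exp (-x) *
      x ^ (5/3 : ℝ) := by positivity
  have h := mul_le_mul_of_nonneg_left (abs_laplace_integral_sub_le hx) hM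
  nth_rw 1 [← abs_of_nonneg hM] at h
  rw [← abs_mul] at h
  rw [hK, p1, p2]
  refine (le_of_eq (congrArg _ ?_)).trans (h.trans (le_of_eq ?_))
  · field_simp
  · ring

lemma measurable_besselK (ν : ℝ) : Measurable (besselK ν) := by
  have h : StronglyMeasurable fun x : ℝ =>
      ∫ t in Set.Ioi (1:ℝ), Real.exp (-x * t) * (t^2 - 1) ^ (ν - 1/2) := by
    refine StronglyMeasurable.integral_prod_right (Measurable.stronglyMeasurable ?_)
    simp only [Function.uncurry_def]
    fun_prop
  unfold besselK
  exact (by fun_prop : Measurable fun x : ℝ =>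
    (Real.sqrt Real.pi / Real.Gamma (ν + 1/2)) * (x/2) ^ ν).mul h.measurable

lemma integrableOn_exp_neg_mul_rpow {a x : ℝ} (ha : a ≤ 0) (hx : 1 ≤ x) :
    IntegrableOn (fun t : ℝ => Real.exp (-t) * t ^ a) (Set.Ioi x) := by
  refine Integrable.mono' (integrableOn_exp_neg_Ioi x)
    (Measurable.aestronglyMeasurable (by fun_prop)) ?_
  refine (ae_restrict_iff' measurableSet_Ioi).2 (Eventually.of_forall fun t ht => ?_)
  have ht : 1 ≤ t := hx.trans (le_of_lt ht)
  rw [Real.norm_of_nonneg (by positivity)]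
  exact mul_le_of_le_one_right (Real.exp_pos _).le (Real.rpow_le_one_of_one_le_of_nonpos ht ha)

lemma integral_exp_neg_mul_rpow_le {a x : ℝ} (ha : a ≤ 0) (hx : 1 ≤ x) :
    ∫ t in Set.Ioi x, Real.exp (-t) * t ^ a ≤ Real.exp (-x) * x ^ a := by
  rw [← integral_exp_neg_Ioi x, ← integral_mul_const]
  refine setIntegral_mono_on (integrableOn_exp_neg_mul_rpow ha hx)
    ((integrableOn_exp_neg_Ioi x).mul_const _) measurableSet_Ioi fun t ht => ?_
  have h := Real.rpow_le_rpow_of_nonpos (by linarith) (le_of_lt ht) ha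
  gcongr

lemma integral_exp_neg_mul_rpow_recurrence {a x : ℝ} (ha : a ≤ 0) (hx : 1 ≤ x) :
    ∫ t in Set.Ioi x, Real.exp (-t) * t ^ a =
      Real.exp (-x) * x ^ a + a * ∫ t in Set.Ioi x, Real.exp (-t) * t ^ (a - 1) := by
  have i1 := integrableOn_exp_neg_mul_rpow ha hx
  have i2 := (integrableOn_exp_neg_mul_rpow (a := a - 1) (by linarith) hx).const_mul a
  have hd : ∀ t ∈ Set.Ici x, HasDerivAt (fun t : ℝ => -(Real.exp (-t) * t ^ a))
      (Real.exp (-t) * t ^ a - a * (Real.exp (-t) * t ^ (a - 1))) t := fun t ht => by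
    have ht : 0 < t := by linarith [show x ≤ t from ht]
    refine (((hasDerivAt_neg t).exp.mul
      (Real.hasDerivAt_rpow_const (p := a) (Or.inl ht.ne'))).neg).congr_deriv ?_
    ring
  have hl : Tendsto (fun t : ℝ => -(Real.exp (-t) * t ^ a)) atTop (nhds 0) := by
    have h := (tendsto_rpow_mul_exp_neg_mul_atTop_nhds_zero a 1 one_pos).neg
    simpa [mul_comm] using h
  have h := integral_Ioi_of_hasDerivAt_of_tendsto' hd (i1.sub i2) hl
  rw [integral_sub i1 i2, integral_const_mul] at h
  linarith

/-- As x → ∞,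
F(x) − √(πx/2) e^{−x} [1 + (55/72)(1/x) − (10151/10368)(1/x²)] = O(e^{−x} x^{−5/2}). -/
theorem synchrotronF_large_x_expansion :
    (fun x : ℝ => synchrotronF x -
        Real.sqrt (Real.pi * x / 2) * Real.exp (-x) *
          (1 + (55/72) * (1/x) - (10151/10368) * (1/x^2)))
      =O[atTop] (fun x : ℝ => Real.exp (-x) * x ^ (-(5:ℝ)/2)) := by
  obtain ⟨C, hC, hK⟩ := exists_abs_besselK_sub_le
  refine IsBigO.of_bound (C + Real.sqrt (Real.pi / 2) * (50755/20736)) ?_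
  filter_upwards [eventually_ge_atTop 1] with x hx
  have hx0 : 0 < x := by linarith
  set A := Real.sqrt (Real.pi / 2) with hA
  have hA0 : 0 ≤ A := Real.sqrt_nonneg _
  have i1 := integrableOn_exp_neg_mul_rpow (a := -(1:ℝ)/2) (by norm_num) hx
  have i3 := integrableOn_exp_neg_mul_rpow (a := -(3:ℝ)/2) (by norm_num) hx
  have i5 := integrableOn_exp_neg_mul_rpow (a := -(5:ℝ)/2) (by norm_num) hx
  have i7 := integrableOn_exp_neg_mul_rpow (a := -(7:ℝ)/2) (by norm_num) hx
  have r1 := integral_exp_neg_mul_rpow_recurrence (a := -(1:ℝ)/2) (by norm_num) hx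
  have r3 := integral_exp_neg_mul_rpow_recurrence (a := -(3:ℝ)/2) (by norm_num) hx
  have r5 := integral_exp_neg_mul_rpow_recurrence (a := -(5:ℝ)/2) (by norm_num) hx
  have b7 := integral_exp_neg_mul_rpow_le (a := -(7:ℝ)/2) (by norm_num) hx
  have n7 : 0 ≤ ∫ t in Set.Ioi x, Real.exp (-t) * t ^ (-(7:ℝ)/2) :=
    setIntegral_nonneg measurableSet_Ioi fun t ht => by
      have : 0 < t := hx0.trans ht
      positivity
  rw [show -(1:ℝ)/2 - 1 = -3/2 by norm_num] at r1
  rw [show -(3:ℝ)/2 - 1 = -5/2 by norm_num] at r3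
  rw [show -(5:ℝ)/2 - 1 = -7/2 by norm_num] at r5
  set P : ℝ → ℝ := fun t => A * (Real.exp (-t) * t ^ (-(1:ℝ)/2)) +
    A * (91/72) * (Real.exp (-t) * t ^ (-(3:ℝ)/2)) +
    A * (1729/10368) * (Real.exp (-t) * t ^ (-(5:ℝ)/2)) with hP
  have j1 := i1.const_mul A
  have j3 := i3.const_mul (A * (91/72))
  have j5 := i5.const_mul (A * (1729/10368))
  have j13 := j1.add j3
  have iP : IntegrableOn P (Set.Ioi x) := j13.add j5
  have eP : ∫ t in Set.Ioi x, P t =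
      A * (∫ t in Set.Ioi x, Real.exp (-t) * t ^ (-(1:ℝ)/2)) +
      A * (91/72) * (∫ t in Set.Ioi x, Real.exp (-t) * t ^ (-(3:ℝ)/2)) +
      A * (1729/10368) * (∫ t in Set.Ioi x, Real.exp (-t) * t ^ (-(5:ℝ)/2)) := by
    refine (integral_add j13 j5).trans ?_
    simp only [Pi.add_apply]
    rw [integral_add j1 j3]
    simp only [integral_const_mul]
  have hpow : ∀ t : ℝ, 0 < t → t ^ (-(3:ℝ)/2) = t ^ (-(1:ℝ)/2) * (1/t) ∧
      t ^ (-(5:ℝ)/2) = t ^ (-(1:ℝ)/2) * (1/t^2) := fun t ht => by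
    constructor
    · rw [one_div, ← Real.rpow_neg_one, ← Real.rpow_add ht]; norm_num
    · rw [one_div, ← Real.rpow_natCast, ← Real.rpow_neg ht.le, ← Real.rpow_add ht]; norm_num
  have hb : ∀ᵐ t ∂volume.restrict (Set.Ioi x),
      ‖besselK (5/3) t - P t‖ ≤ C * (Real.exp (-t) * t ^ (-(7:ℝ)/2)) := by
    refine (ae_restrict_iff' measurableSet_Ioi).2 (Eventually.of_forall fun t ht => ?_)
    have ht : 0 < t := hx0.trans ht
    convert hK t ht using 1
    rw [Real.norm_eq_abs]
    congr 2
    simp only [hP, (hpow t ht).1, (hpow t ht).2]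
    ring
  have iR : IntegrableOn (fun t => besselK (5/3) t - P t) (Set.Ioi x) := by
    refine Integrable.mono' (i7.const_mul C) (Measurable.aestronglyMeasurable ?_) hb
    have := measurable_besselK (5/3)
    simp only [hP]
    fun_prop
  have eK : ∫ t in Set.Ioi x, besselK (5/3) t =
      (∫ t in Set.Ioi x, P t) + ∫ t in Set.Ioi x, (besselK (5/3) t - P t) := by
    rw [← integral_add iP iR]; simp only [add_sub_cancel]
  have hR := norm_integral_le_of_norm_le (i7.const_mul C) hb
  rw [integral_const_mul, Real.norm_eq_abs] at hR
  have hs : Real.sqrt (Real.pi * x / 2) = A * (x * x ^ (-(1:ℝ)/2)) := by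
    rw [show Real.pi * x / 2 = Real.pi / 2 * x by ring, Real.sqrt_mul (by positivity),
      Real.sqrt_eq_rpow x, ← Real.rpow_one_add' hx0.le (by norm_num),
      show (1:ℝ) + -1/2 = 1/2 by norm_num]
  have h5 : x ^ (-(5:ℝ)/2) = x * x ^ (-(7:ℝ)/2) := by
    rw [← Real.rpow_one_add' hx0.le (by norm_num)]; norm_num
  have hmain : synchrotronF x - Real.sqrt (Real.pi * x / 2) * Real.exp (-x) *
      (1 + (55/72) * (1/x) - (10151/10368) * (1/x^2)) =
      x * ((∫ t in Set.Ioi x, (besselK (5/3) t - P t)) + A * (50755/20736) *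
        ∫ t in Set.Ioi x, Real.exp (-t) * t ^ (-(7:ℝ)/2)) := by
    rw [synchrotronF, eK, eP, r1, r3, r5, hs, (hpow x hx0).1, (hpow x hx0).2]
    ring
  rw [hmain, norm_mul, Real.norm_of_nonneg hx0.le,
    Real.norm_of_nonneg (show 0 ≤ Real.exp (-x) * x ^ (-(5:ℝ)/2) by positivity), Real.norm_eq_abs]
  calc _ ≤ x * (C * (∫ t in Set.Ioi x, Real.exp (-t) * t ^ (-(7:ℝ)/2)) + A * (50755/20736) *
        ∫ t in Set.Ioi x, Real.exp (-t) * t ^ (-(7:ℝ)/2)) := by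
        gcongr
        refine (abs_add_le _ _).trans (add_le_add hR (le_of_eq (abs_of_nonneg (by positivity))))
    _ ≤ x * (C * (Real.exp (-x) * x ^ (-(7:ℝ)/2)) +
        A * (50755/20736) * (Real.exp (-x) * x ^ (-(7:ℝ)/2))) := by gcongr
    _ = _ := by rw [h5]; ring
end
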